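/- arXiv:1511.07406 — 5 statements merged into one kernel-verified Lean document; each statement's English description precedes it below -/
import Mathlib

section
/- Let H ∈ C¹(ℝ, L₂(H)) be such that (i) t ↦ ‖H(t)‖_HS is bounded, (ii) the family (h_{i,j})_{i,j∈ℕ} is balanced, (iii) there exists a pointwise bounded and balanced family of measurable functions (g_{i,j})_{i,j∈ℕ} on ℝ with h_{i,i}'(t) = Σ_{j=0}^∞ g_{i,j}(t)|h_{i,j}(t)|² for all t ∈ ℝ and i ∈ ℕ. Suppose there exist T > 0 and signs (ε_ℓ)_{ℓ∈ℕ} ∈ {−1,1}^ℕ such that ε_ℓ g_{ℓ,k}(t) ≥ 0 for all t ≥ T and all k ≥ ℓ. Then for every ℓ ∈ ℕ one has Σ_{j=0}^∞ ∫_T^∞ |g_{ℓ,j}(t)||h_{ℓ,j}(t)|² dt < +∞, and each diagonal coefficient h_{ℓ,ℓ}(t) converges to a finite limit as t → +∞. -/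
open MeasureTheory Filter Set
open scoped RealInnerProductSpace

/-- If a bounded differentiable function has derivative equal, up to a sign, to an integrable
function plus a nonnegative one on `[T, ∞)`, then the nonnegative part is integrable. -/
theorem integrableOn_Ici_of_bounded_of_hasDerivAt {f f' F : ℝ → ℝ} {T B ε : ℝ}
    (hf : ∀ t, HasDerivAt f (f' t) t) (hf' : Continuous f') (hB : ∀ t, |f t| ≤ B)
    (hF : IntegrableOn F (Ici T)) (hε : |ε| = 1)
    (hpos : ∀ t ∈ Ici T, 0 ≤ ε * (f' t - F t)) :
    IntegrableOn (fun t => ε * (f' t - F t)) (Ici T) := by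
  rw [integrableOn_Ici_iff_integrableOn_Ioi]
  have hFi : ∀ b ≥ T, IntervalIntegrable F volume T b := fun b hb =>
    (intervalIntegrable_iff_integrableOn_Ioc_of_le hb).2
      (hF.mono_set fun x hx => hx.1.le)
  have hf'i : ∀ b, IntervalIntegrable f' volume T b := fun b => hf'.intervalIntegrable T b
  refine integrableOn_Ioi_of_intervalIntegral_norm_bounded
    (l := atTop) (b := fun b : ℝ => max b T)
    (2 * B + ∫ t in Ici T, |F t|) T (fun b => ?_) ?_ ?_
  · exact ((intervalIntegrable_iff_integrableOn_Ioc_of_le (le_max_right b T)).1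
      (((hf'i _).sub (hFi _ (le_max_right b T))).const_mul ε))
  · exact tendsto_atTop_mono (fun b => le_max_left b T) tendsto_id
  · refine Eventually.of_forall fun b => ?_
    have hb : T ≤ max b T := le_max_right b T
    generalize max b T = c at hb
    have hnorm : ∫ t in T..c, ‖ε * (f' t - F t)‖ = ∫ t in T..c, ε * (f' t - F t) := by
      refine intervalIntegral.integral_congr fun t ht => ?_
      rw [uIcc_of_le hb] at ht
      exact Real.norm_of_nonneg (hpos t ht.1)
    have habs : |∫ t in T..c, F t| ≤ ∫ t in Ici T, |F t| := by
      refine (intervalIntegral.abs_integral_le_integral_abs hb).trans ?_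
      rw [intervalIntegral.integral_of_le hb]
      exact setIntegral_mono_set hF.abs (Eventually.of_forall fun t => abs_nonneg _)
        (Eventually.of_forall fun x hx => hx.1.le)
    rw [hnorm, intervalIntegral.integral_const_mul, intervalIntegral.integral_sub (hf'i c) (hFi c hb),
      intervalIntegral.integral_eq_sub_of_hasDerivAt (fun t _ => hf t) (hf'i c)]
    refine (le_abs_self _).trans ?_
    rw [abs_mul, hε, one_mul]
    have h₁ := abs_sub (f c - f T) (∫ t in T..c, F t)
    have h₂ := abs_sub (f c) (f T)
    linarith [hB c, hB T]

/-- The coordinates of a Hilbert–Schmidt operator are bounded by its norm. -/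
theorem abs_inner_le_sqrt_of_tsum_le {𝓗 : Type*} [NormedAddCommGroup 𝓗] [InnerProductSpace ℝ 𝓗]
    (e : HilbertBasis ℕ ℝ 𝓗) {A : 𝓗 →L[ℝ] 𝓗} {M : ℝ}
    (hA : Summable fun n => ‖A (e n)‖ ^ 2) (hM : (∑' n, ‖A (e n)‖ ^ 2) ≤ M) (i j : ℕ) :
    |⟪A (e i), e j⟫| ≤ √M := by
  have h₁ : |⟪A (e i), e j⟫| ≤ ‖A (e i)‖ := by
    simpa [e.orthonormal.1 j] using abs_real_inner_le_norm (A (e i)) (e j)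
  refine h₁.trans (Real.le_sqrt_of_sq_le ?_)
  exact (hA.le_tsum i fun n _ => sq_nonneg _).trans hM

/-- main convergence theorem, first part. Let `H ∈ C¹(ℝ, L₂(𝓗))` with
`t ↦ ‖H(t)‖_HS` bounded, the matrix coefficients `h i j t = ⟪H t (e i), e j⟫` balanced, and
suppose that there is a pointwise bounded and balanced family of measurable functions
`g i j` with `h_{i,i}'(t) = Σ_j g i j t * |h i j t|²`. If there are `T > 0` and signs
`ε ℓ ∈ {−1,1}` with `ε ℓ * g ℓ k t ≥ 0` for all `t ≥ T` and `k ≥ ℓ`, then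
`Σ_j ∫_T^∞ |g ℓ j| |h ℓ j|² dt < ∞` for every `ℓ`, and each diagonal coefficient
`h ℓ ℓ` converges to a finite limit at `+∞`. -/
theorem stmt2
    {𝓗 : Type*} [NormedAddCommGroup 𝓗] [InnerProductSpace ℝ 𝓗] [CompleteSpace 𝓗]
    (e : HilbertBasis ℕ ℝ 𝓗)
    (H H' : ℝ → 𝓗 →L[ℝ] 𝓗)
    (hC1 : ∀ t : ℝ, HasDerivAt H (H' t) t) (hC1' : Continuous H')
    (hHS : ∀ t : ℝ, Summable fun n => ‖H t (e n)‖ ^ 2)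
    (hHSbdd : ∃ M : ℝ, ∀ t : ℝ, (∑' n, ‖H t (e n)‖ ^ 2) ≤ M)
    (h : ℕ → ℕ → ℝ → ℝ)
    (hdef : ∀ i j t, h i j t = ⟪H t (e i), e j⟫)
    (hbal : ∀ i j : ℕ, ∃ c : ℝ → ℝ, Measurable c ∧ (∃ B : ℝ, ∀ t, 0 ≤ c t ∧ c t ≤ B) ∧
      ∀ t, |h i j t| ≤ c t * |h j i t|)
    (g : ℕ → ℕ → ℝ → ℝ)
    (hgmeas : ∀ i j, Measurable (g i j))
    (hgptbdd : ∀ t : ℝ, ∃ M : ℝ, ∀ i j, |g i j t| ≤ M)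
    (hgbal : ∀ i j : ℕ, ∃ c : ℝ → ℝ, Measurable c ∧ (∃ B : ℝ, ∀ t, 0 ≤ c t ∧ c t ≤ B) ∧
      ∀ t, |g i j t| ≤ c t * |g j i t|)
    (hODE : ∀ i : ℕ, ∀ t : ℝ, HasSum (fun j => g i j t * (h i j t) ^ 2) (deriv (h i i) t))
    (T : ℝ) (hT : 0 < T)
    (ε : ℕ → ℝ) (hε : ∀ ℓ, ε ℓ = 1 ∨ ε ℓ = -1)
    (hsign : ∀ t ≥ T, ∀ k ℓ : ℕ, ℓ ≤ k → 0 ≤ ε ℓ * g ℓ k t) :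
    (∀ ℓ : ℕ,
      (∑' j : ℕ, ∫⁻ t in Ici T, ENNReal.ofReal (|g ℓ j t| * (h ℓ j t) ^ 2)) < ⊤) ∧
    (∀ ℓ : ℕ, ∃ L : ℝ, Tendsto (fun t => h ℓ ℓ t) atTop (nhds L)) := by
  obtain ⟨M, hM⟩ := hHSbdd
  have hder : ∀ i j t, HasDerivAt (h i j) ⟪H' t (e i), e j⟫ t := fun i j t => by
    have h₁ : HasDerivAt (fun s => ⟪H s (e i), e j⟫) ⟪H' t (e i), e j⟫ t := by
      simpa using ((hC1 t).clm_apply (hasDerivAt_const t (e i))).inner ℝ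
        (hasDerivAt_const t (e j))
    exact (funext (hdef i j) : h i j = _) ▸ h₁
  have hcont : ∀ i j, Continuous (h i j) := fun i j =>
    continuous_iff_continuousAt.2 fun t => (hder i j t).continuousAt
  have hcont' : ∀ i, Continuous fun t => ⟪H' t (e i), e i⟫ := fun i => by fun_prop
  have hbd : ∀ i t, |h i i t| ≤ √M := fun i t => by
    rw [hdef]; exact abs_inner_le_sqrt_of_tsum_le e (hHS t) (hM t) i i
  have hmeas : ∀ i j, Measurable fun t => g i j t * h i j t ^ 2 := fun i j =>
    (hgmeas i j).mul ((hcont i j).measurable.pow_const 2)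
  -- Balancedness transfers integrability across the diagonal.
  have hswap : ∀ i j, IntegrableOn (fun t => g j i t * h j i t ^ 2) (Ici T) →
      IntegrableOn (fun t => g i j t * h i j t ^ 2) (Ici T) := by
    intro i j hji
    obtain ⟨c, -, ⟨B, hB⟩, hc⟩ := hbal i j
    obtain ⟨d, -, ⟨D, hD⟩, hd⟩ := hgbal i j
    refine (hji.const_mul (D * B ^ 2)).mono (hmeas i j).aestronglyMeasurable
      (Eventually.of_forall fun t => ?_)
    have hB₀ : 0 ≤ B := (hB t).1.trans (hB t).2
    have hD₀ : 0 ≤ D := (hD t).1.trans (hD t).2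
    have h₁ : |h i j t| ≤ B * |h j i t| :=
      (hc t).trans (mul_le_mul_of_nonneg_right (hB t).2 (abs_nonneg _))
    have h₂ : |g i j t| ≤ D * |g j i t| :=
      (hd t).trans (mul_le_mul_of_nonneg_right (hD t).2 (abs_nonneg _))
    simp only [norm_mul, norm_pow, Real.norm_eq_abs, abs_of_nonneg hB₀, abs_of_nonneg hD₀]
    calc |g i j t| * |h i j t| ^ 2 ≤ (D * |g j i t|) * (B * |h j i t|) ^ 2 := by gcongr
      _ = D * B ^ 2 * (|g j i t| * |h j i t| ^ 2) := by ring
  have key : ∀ ℓ, (∀ j, IntegrableOn (fun t => g ℓ j t * h ℓ j t ^ 2) (Ici T)) ∧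
      (∑' j : ℕ, ∫⁻ t in Ici T, ENNReal.ofReal (|g ℓ j t| * (h ℓ j t) ^ 2)) < ⊤ ∧
      ∃ L : ℝ, Tendsto (fun t => h ℓ ℓ t) atTop (nhds L) := by
    intro ℓ
    induction ℓ using Nat.strong_induction_on with
    | _ ℓ ih =>
    have hlow : ∀ j ∈ Finset.range ℓ, IntegrableOn (fun t => g ℓ j t * h ℓ j t ^ 2) (Ici T) :=
      fun j hj => hswap ℓ j ((ih j (Finset.mem_range.1 hj)).1 ℓ)
    have hF : IntegrableOn (fun t => ∑ j ∈ Finset.range ℓ, g ℓ j t * h ℓ j t ^ 2) (Ici T) :=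
      integrable_finsetSum _ hlow
    have hεabs : |ε ℓ| = 1 := by rcases hε ℓ with h | h <;> simp [h]
    have hsum : ∀ t ∈ Ici T, HasSum (fun j => |g ℓ (j + ℓ) t| * h ℓ (j + ℓ) t ^ 2)
        (ε ℓ * (⟪H' t (e ℓ), e ℓ⟫ - ∑ j ∈ Finset.range ℓ, g ℓ j t * h ℓ j t ^ 2)) := by
      intro t ht
      have h₁ := hODE ℓ t
      rw [(hder ℓ ℓ t).deriv] at h₁
      have h₂ := ((hasSum_nat_add_iff' ℓ).2 h₁).mul_left (ε ℓ)
      refine h₂.congr_fun fun j => ?_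
      have h₃ := hsign t ht (j + ℓ) ℓ (Nat.le_add_left _ _)
      rw [← mul_assoc, ← abs_of_nonneg h₃, abs_mul, hεabs, one_mul]
    have hint := integrableOn_Ici_of_bounded_of_hasDerivAt (hder ℓ ℓ) (hcont' ℓ) (hbd ℓ) hF
      hεabs fun t ht => (hsum t ht).nonneg fun j => by positivity
    have hofReal : ∀ j t, ENNReal.ofReal (|g ℓ j t| * h ℓ j t ^ 2) = ‖g ℓ j t * h ℓ j t ^ 2‖ₑ :=
      fun j t => by rw [← ofReal_norm, norm_mul, Real.norm_eq_abs, norm_pow,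
        Real.norm_eq_abs, sq_abs]
    have htail : (∑' j, ∫⁻ t in Ici T, ENNReal.ofReal (|g ℓ (j + ℓ) t| * h ℓ (j + ℓ) t ^ 2))
        < ⊤ := by
      rw [← lintegral_tsum fun j => by
        simp_rw [hofReal]; exact (hmeas ℓ (j + ℓ)).enorm.aemeasurable]
      refine lt_of_le_of_lt (le_of_eq ?_) hint.lintegral_lt_top
      refine setLIntegral_congr_fun measurableSet_Ici fun t ht => ?_
      exact ((hsum t ht).tsum_eq ▸ ENNReal.ofReal_tsum_of_nonneg
        (fun j => by positivity) (hsum t ht).summable).symm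
    have hall : (∑' j, ∫⁻ t in Ici T, ENNReal.ofReal (|g ℓ j t| * h ℓ j t ^ 2)) < ⊤ := by
      rw [← ENNReal.summable.sum_add_tsum_nat_add' (k := ℓ)]
      refine ENNReal.add_lt_top.2 ⟨ENNReal.sum_lt_top.2 fun j hj => ?_, htail⟩
      simp_rw [hofReal]
      exact (hlow j hj).hasFiniteIntegral
    refine ⟨fun j => ⟨(hmeas ℓ j).aestronglyMeasurable, ?_⟩, hall, ?_⟩
    · have h₁ := (ENNReal.le_tsum j).trans_lt hall
      simp_rw [hofReal] at h₁
      exact h₁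
    · have h₁ : IntegrableOn (fun t => ⟪H' t (e ℓ), e ℓ⟫) (Ici T) := by
        refine ((hint.const_mul (ε ℓ)).add hF).congr (Eventually.of_forall fun t => ?_)
        rcases hε ℓ with h | h <;> simp [h]
      exact ⟨_, tendsto_limUnder_of_hasDerivAt_of_integrableOn_Ioi (fun t _ => hder ℓ ℓ t)
        (h₁.mono_set Ioi_subset_Ici_self)⟩
  exact ⟨fun ℓ => (key ℓ).2.1, fun ℓ => (key ℓ).2.2⟩
end

section
/- Let H ∈ C¹(ℝ, L₂(H)) satisfy: t ↦ ‖H(t)‖_HS is bounded; (h_{i,j}) is balanced; there is a pointwise bounded balanced family of measurable functions (g_{i,j}) with h_{i,i}'(t) = Σ_{j=0}^∞ g_{i,j}(t)|h_{i,j}(t)|²; and there exist T > 0 and signs (ε_ℓ) ∈ {−1,1}^ℕ with ε_ℓ g_{ℓ,k}(t) ≥ 0 for all t ≥ T and k ≥ ℓ. If in addition for every ℓ ∈ ℕ there exists c_ℓ > 0 such that |g_{ℓ,j}(t)| ≥ c_ℓ for all j ≠ ℓ and all t ≥ T, then for every ℓ ∈ ℕ: Σ_{j≠ℓ} ∫_T^∞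 |h_{ℓ,j}(t)|² dt = ∫_T^∞ ‖H(t)e_ℓ − h_{ℓ,ℓ}(t)e_ℓ‖² dt < +∞. -/
open MeasureTheory Filter Set
open scoped RealInnerProductSpace

/-- If `φ` is bounded and `C¹` and `S = φ' + R ≥ 0` on a half-line on which `R` is integrable,
then `S` is integrable there. -/
theorem integrableOn_Ioi_of_eq_deriv_add {φ φ' S R : ℝ → ℝ} {T K : ℝ}
    (hφ : ∀ t, HasDerivAt φ (φ' t) t) (hφ' : Continuous φ') (hK : ∀ t, |φ t| ≤ K)
    (hS : ∀ t ∈ Ioi T, S t = φ' t + R t) (hS0 : ∀ t ∈ Ioi T, 0 ≤ S t)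
    (hR : IntegrableOn R (Ioi T)) : IntegrableOn S (Ioi T) := by
  have key : IntegrableOn (fun t => φ' t + R t) (Ioi T) := by
    have hIoc : ∀ b, IntegrableOn R (Ioc T b) := fun b => hR.mono_set Ioc_subset_Ioi_self
    have hIoc' : ∀ b, IntegrableOn φ' (Ioc T b) := fun b =>
      (hφ'.integrableOn_Icc).mono_set Ioc_subset_Icc_self
    refine integrableOn_Ioi_of_intervalIntegral_norm_bounded (l := atTop) (b := id)
      (2 * K + ∫ t in Ioi T, |R t|) T (fun b => (hIoc' b).add (hIoc b)) tendsto_id ?_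
    filter_upwards [eventually_ge_atTop T] with b hb
    have h1 : ∫ t in T..b, ‖φ' t + R t‖ = ∫ t in T..b, (φ' t + R t) := by
      rw [intervalIntegral.integral_of_le hb, intervalIntegral.integral_of_le hb]
      refine setIntegral_congr_fun measurableSet_Ioc fun t ht => ?_
      have := hS0 t ht.1
      rw [hS t ht.1] at this
      exact Real.norm_of_nonneg this
    have h2 : ∫ t in T..b, (φ' t + R t) = (φ b - φ T) + ∫ t in T..b, R t := by
      rw [intervalIntegral.integral_add (hφ'.intervalIntegrable _ _)
        ((intervalIntegrable_iff_integrableOn_Ioc_of_le hb).2 (hIoc b)),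
        intervalIntegral.integral_eq_sub_of_hasDerivAt (fun t _ => hφ t)
          (hφ'.intervalIntegrable _ _)]
    have h3 : ∫ t in T..b, R t ≤ ∫ t in Ioi T, |R t| := by
      rw [intervalIntegral.integral_of_le hb]
      calc ∫ t in Ioc T b, R t ≤ ∫ t in Ioc T b, |R t| :=
            integral_mono (hIoc b) (hIoc b).abs fun t => le_abs_self _
        _ ≤ ∫ t in Ioi T, |R t| :=
            setIntegral_mono_set hR.abs (ae_of_all _ fun t => abs_nonneg _)
              Ioc_subset_Ioi_self.eventuallyLE
    have h4 := abs_le.1 (hK b)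
    have h5 := abs_le.1 (hK T)
    simp only [id]
    rw [h1, h2]
    linarith [h4.2, h5.1]
  exact key.congr_fun (fun t ht => (hS t ht).symm) measurableSet_Ioi

/-- Parseval's identity for the component of `x` orthogonal to a basis vector. -/
theorem HilbertBasis.hasSum_sq_inner_ne {𝓗 : Type*} [NormedAddCommGroup 𝓗]
    [InnerProductSpace ℝ 𝓗] (e : HilbertBasis ℕ ℝ 𝓗) (x : 𝓗) (ℓ : ℕ) :
    HasSum (fun j : {j : ℕ // j ≠ ℓ} => ⟪x, e j⟫ ^ 2) (‖x - ⟪x, e ℓ⟫ • e ℓ‖ ^ 2) := by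
  have hsum := e.hasSum_inner_mul_inner (x - ⟪x, e ℓ⟫ • e ℓ) (x - ⟪x, e ℓ⟫ • e ℓ)
  rw [real_inner_self_eq_norm_sq] at hsum
  have hcoef : ∀ j, ⟪x - ⟪x, e ℓ⟫ • e ℓ, e j⟫ = if j = ℓ then 0 else ⟪x, e j⟫ := by
    intro j
    rw [inner_sub_left, real_inner_smul_left, orthonormal_iff_ite.1 e.orthonormal]
    by_cases hj : j = ℓ
    · simp [hj]
    · simp [hj, Ne.symm hj]
  have hterm : ∀ j, ⟪x - ⟪x, e ℓ⟫ • e ℓ, e j⟫ * ⟪e j, x - ⟪x, e ℓ⟫ • e ℓ⟫ =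
      {j : ℕ | j ≠ ℓ}.indicator (fun j => ⟪x, e j⟫ ^ 2) j := by
    intro j
    rw [real_inner_comm _ (e j), hcoef]
    by_cases hj : j = ℓ <;> simp [hj, sq]
  simp only [hterm] at hsum
  exact hasSum_subtype_iff_indicator.2 hsum

/-- main convergence theorem, stronger integrability. Under the hypotheses
of the main theorem, if moreover for every `ℓ` there is `c ℓ > 0` with `|g ℓ j t| ≥ c ℓ` for
all `j ≠ ℓ` and `t ≥ T`, then for every `ℓ`,
`Σ_{j≠ℓ} ∫_T^∞ |h ℓ j t|² dt = ∫_T^∞ ‖H(t)e_ℓ − h_{ℓ,ℓ}(t) e_ℓ‖² dt < +∞`. -/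
theorem stmt3
    {𝓗 : Type*} [NormedAddCommGroup 𝓗] [InnerProductSpace ℝ 𝓗] [CompleteSpace 𝓗]
    (e : HilbertBasis ℕ ℝ 𝓗)
    (H H' : ℝ → 𝓗 →L[ℝ] 𝓗)
    (hC1 : ∀ t : ℝ, HasDerivAt H (H' t) t) (hC1' : Continuous H')
    (hHS : ∀ t : ℝ, Summable fun n => ‖H t (e n)‖ ^ 2)
    (hHSbdd : ∃ M : ℝ, ∀ t : ℝ, (∑' n, ‖H t (e n)‖ ^ 2) ≤ M)
    (h : ℕ → ℕ → ℝ → ℝ)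
    (hdef : ∀ i j t, h i j t = ⟪H t (e i), e j⟫)
    (hbal : ∀ i j : ℕ, ∃ c : ℝ → ℝ, Measurable c ∧ (∃ B : ℝ, ∀ t, 0 ≤ c t ∧ c t ≤ B) ∧
      ∀ t, |h i j t| ≤ c t * |h j i t|)
    (g : ℕ → ℕ → ℝ → ℝ)
    (hgmeas : ∀ i j, Measurable (g i j))
    (hgptbdd : ∀ t : ℝ, ∃ M : ℝ, ∀ i j, |g i j t| ≤ M)
    (hgbal : ∀ i j : ℕ, ∃ c : ℝ → ℝ, Measurable c ∧ (∃ B : ℝ, ∀ t, 0 ≤ c t ∧ c t ≤ B) ∧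
      ∀ t, |g i j t| ≤ c t * |g j i t|)
    (hODE : ∀ i : ℕ, ∀ t : ℝ, HasSum (fun j => g i j t * (h i j t) ^ 2) (deriv (h i i) t))
    (T : ℝ) (hT : 0 < T)
    (ε : ℕ → ℝ) (hε : ∀ ℓ, ε ℓ = 1 ∨ ε ℓ = -1)
    (hsign : ∀ t ≥ T, ∀ k ℓ : ℕ, ℓ ≤ k → 0 ≤ ε ℓ * g ℓ k t)
    (hlow : ∀ ℓ : ℕ, ∃ c : ℝ, 0 < c ∧ ∀ j : ℕ, j ≠ ℓ → ∀ t ≥ T, c ≤ |g ℓ j t|) :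
    ∀ ℓ : ℕ,
      (∑' j : {j : ℕ // j ≠ ℓ}, ∫⁻ t in Ici T, ENNReal.ofReal ((h ℓ (j : ℕ) t) ^ 2)) =
        (∫⁻ t in Ici T, ENNReal.ofReal (‖H t (e ℓ) - h ℓ ℓ t • e ℓ‖ ^ 2)) ∧
      (∫⁻ t in Ici T, ENNReal.ofReal (‖H t (e ℓ) - h ℓ ℓ t • e ℓ‖ ^ 2)) < ⊤ := by
  obtain ⟨M, hM⟩ := hHSbdd
  have hderiv : ∀ i j t, HasDerivAt (h i j) ⟪H' t (e i), e j⟫ t := by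
    intro i j t
    have h1 : HasDerivAt (fun s => H s (e i)) (H' t (e i)) t := by
      simpa using (hC1 t).clm_apply (hasDerivAt_const t (e i))
    rw [show h i j = fun s => ⟪H s (e i), e j⟫ from funext (hdef i j)]
    simpa using h1.inner ℝ (hasDerivAt_const t (e j))
  have hcont' : ∀ i j, Continuous fun t => ⟪H' t (e i), e j⟫ := fun i j =>
    (hC1'.clm_apply continuous_const).inner continuous_const
  have hmeas : ∀ i j, Measurable (h i j) := fun i j =>
    (continuous_iff_continuousAt.2 fun t => (hderiv i j t).continuousAt).measurable
  have hbound : ∀ i t, |h i i t| ≤ 1 + M := by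
    intro i t
    have h1 : |h i i t| ≤ ‖H t (e i)‖ := by
      rw [hdef]
      simpa [e.orthonormal.1 i] using abs_real_inner_le_norm (H t (e i)) (e i)
    have h2 : ‖H t (e i)‖ ^ 2 ≤ M :=
      ((hHS t).le_tsum i fun _ _ => sq_nonneg _).trans (hM t)
    nlinarith [sq_nonneg (‖H t (e i)‖ - 1)]
  have hsummable : ∀ i t, Summable fun j => |g i j t| * h i j t ^ 2 := by
    intro i t
    simpa [abs_mul] using (hODE i t).summable.abs
  have hterm_nonneg : ∀ i j t, 0 ≤ |g i j t| * h i j t ^ 2 := fun i j t => by positivity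
  have hterm_meas : ∀ i j, Measurable fun t => |g i j t| * h i j t ^ 2 := fun i j =>
    ((hgmeas i j).abs).mul ((hmeas i j).pow_const 2)
  have hswap : ∀ i j, ∃ C : ℝ, ∀ t,
      |g i j t| * h i j t ^ 2 ≤ C * (|g j i t| * h j i t ^ 2) := by
    intro i j
    obtain ⟨c, -, ⟨B, hB⟩, hc⟩ := hbal i j
    obtain ⟨d, -, ⟨D, hD⟩, hd⟩ := hgbal i j
    refine ⟨D * B ^ 2, fun t => ?_⟩
    have h1 : |g i j t| ≤ D * |g j i t| :=
      (hd t).trans (mul_le_mul_of_nonneg_right (hD t).2 (abs_nonneg _))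
    have h2 : |h i j t| ≤ B * |h j i t| :=
      (hc t).trans (mul_le_mul_of_nonneg_right (hB t).2 (abs_nonneg _))
    have h3 : h i j t ^ 2 ≤ (B * |h j i t|) ^ 2 := by
      rw [← sq_abs (h i j t)]
      exact pow_le_pow_left₀ (abs_nonneg _) h2 2
    calc |g i j t| * h i j t ^ 2 ≤ (D * |g j i t|) * (B * |h j i t|) ^ 2 :=
          mul_le_mul h1 h3 (sq_nonneg _) ((abs_nonneg _).trans h1)
      _ = D * B ^ 2 * (|g j i t| * h j i t ^ 2) := by rw [mul_pow, sq_abs]; ring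
  have hint : ∀ ℓ, IntegrableOn (fun t => ∑' j, |g ℓ j t| * h ℓ j t ^ 2) (Ioi T) := by
    intro ℓ
    induction ℓ using Nat.strong_induction_on with
    | _ ℓ ih =>
    have hlt : ∀ j < ℓ, IntegrableOn (fun t => |g ℓ j t| * h ℓ j t ^ 2) (Ioi T) := by
      intro j hj
      obtain ⟨C, hC⟩ := hswap ℓ j
      have h1 : IntegrableOn (fun t => |g j ℓ t| * h j ℓ t ^ 2) (Ioi T) := by
        refine (ih j hj).mono' (hterm_meas j ℓ).aestronglyMeasurable (ae_of_all _ fun t => ?_)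
        rw [Real.norm_of_nonneg (hterm_nonneg j ℓ t)]
        exact (hsummable j t).le_tsum ℓ fun k _ => hterm_nonneg j k t
      refine (h1.const_mul C).mono' (hterm_meas ℓ j).aestronglyMeasurable
        (ae_of_all _ fun t => ?_)
      rw [Real.norm_of_nonneg (hterm_nonneg ℓ j t)]
      exact hC t
    have hεabs : |ε ℓ| = 1 := by rcases hε ℓ with h1 | h1 <;> simp [h1]
    have hlt' : ∀ j < ℓ,
        IntegrableOn (fun t => |g ℓ j t| * h ℓ j t ^ 2 - ε ℓ * (g ℓ j t * h ℓ j t ^ 2))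
          (Ioi T) := by
      intro j hj
      refine (hlt j hj).sub (Integrable.const_mul ?_ _)
      refine (hlt j hj).mono'
        ((hgmeas ℓ j).mul ((hmeas ℓ j).pow_const 2)).aestronglyMeasurable
        (ae_of_all _ fun t => ?_)
      simp
    refine integrableOn_Ioi_of_eq_deriv_add (φ := fun t => ε ℓ * h ℓ ℓ t)
      (φ' := fun t => ε ℓ * ⟪H' t (e ℓ), e ℓ⟫) (K := 1 + M)
      (R := fun t => ∑ j ∈ Finset.range ℓ,
        (|g ℓ j t| * h ℓ j t ^ 2 - ε ℓ * (g ℓ j t * h ℓ j t ^ 2)))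
      (fun t => (hderiv ℓ ℓ t).const_mul _) (continuous_const.mul (hcont' ℓ ℓ))
      (fun t => by rw [abs_mul, hεabs, one_mul]; exact hbound ℓ t) ?_
      (fun t _ => tsum_nonneg fun j => hterm_nonneg ℓ j t)
      (integrable_finsetSum _ fun j hj => hlt' j (Finset.mem_range.1 hj))
    intro t ht
    have h1 : HasSum (fun j => ε ℓ * (g ℓ j t * h ℓ j t ^ 2))
        (ε ℓ * ⟪H' t (e ℓ), e ℓ⟫) := by
      rw [← (hderiv ℓ ℓ t).deriv]
      exact (hODE ℓ t).mul_left _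
    have h2 : HasSum (fun j => |g ℓ j t| * h ℓ j t ^ 2 - ε ℓ * (g ℓ j t * h ℓ j t ^ 2))
        (∑ j ∈ Finset.range ℓ,
          (|g ℓ j t| * h ℓ j t ^ 2 - ε ℓ * (g ℓ j t * h ℓ j t ^ 2))) := by
      refine hasSum_sum_of_ne_finset_zero fun j hj => ?_
      have h3 := hsign t (le_of_lt ht) j ℓ (by simpa using hj)
      have h4 : |g ℓ j t| = ε ℓ * g ℓ j t := by
        rw [← abs_of_nonneg h3, abs_mul, hεabs, one_mul]
      rw [h4]
      ring
    have h5 := h1.add h2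
    simp only [add_sub_cancel] at h5
    exact h5.tsum_eq
  intro ℓ
  have hparseval : ∀ t, HasSum (fun j : {j : ℕ // j ≠ ℓ} => h ℓ j t ^ 2)
      (‖H t (e ℓ) - h ℓ ℓ t • e ℓ‖ ^ 2) := by
    intro t
    simpa only [hdef] using e.hasSum_sq_inner_ne (H t (e ℓ)) ℓ
  constructor
  · rw [← lintegral_tsum fun j : {j : ℕ // j ≠ ℓ} =>
      ((hmeas ℓ j).pow_const 2).ennreal_ofReal.aemeasurable]
    refine lintegral_congr fun t => ?_
    rw [← (hparseval t).tsum_eq,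
      ENNReal.ofReal_tsum_of_nonneg (fun j => sq_nonneg _) (hparseval t).summable]
  · obtain ⟨c, hc0, hc⟩ := hlow ℓ
    have hfin : IntegrableOn (fun t => c⁻¹ * ∑' j, |g ℓ j t| * h ℓ j t ^ 2) (Ici T) :=
      ((integrableOn_Ici_iff_integrableOn_Ioi).2 (hint ℓ)).const_mul _
    refine lt_of_le_of_lt (setLIntegral_mono' measurableSet_Ici fun t ht => ?_)
      hfin.lintegral_lt_top
    refine ENNReal.ofReal_le_ofReal ?_
    rw [le_inv_mul_iff₀ hc0]
    calc c * ‖H t (e ℓ) - h ℓ ℓ t • e ℓ‖ ^ 2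
        = ∑' j : {j : ℕ // j ≠ ℓ}, c * h ℓ j t ^ 2 :=
          ((hparseval t).mul_left c).tsum_eq.symm
      _ ≤ ∑' j : {j : ℕ // j ≠ ℓ}, |g ℓ j t| * h ℓ j t ^ 2 :=
          Summable.tsum_le_tsum
            (fun j => mul_le_mul_of_nonneg_right (hc j j.2 t ht) (sq_nonneg _))
            ((hparseval t).summable.mul_left c) ((hsummable ℓ t).subtype {j | j ≠ ℓ})
      _ ≤ ∑' j, |g ℓ j t| * h ℓ j t ^ 2 :=
          (hsummable ℓ t).tsum_subtype_le _ {j | j ≠ ℓ} fun j => hterm_nonneg ℓ j t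
end

section
/- Let H ∈ C¹(ℝ, L₂(H)) satisfy: t ↦ ‖H(t)‖_HS is bounded; (h_{i,j}) is balanced; there is a pointwise bounded balanced family of measurable functions (g_{i,j}) with h_{i,i}'(t) = Σ_{j=0}^∞ g_{i,j}(t)|h_{i,j}(t)|²; there exist T > 0 and signs (ε_ℓ) ∈ {−1,1}^ℕ with ε_ℓ g_{ℓ,k}(t) ≥ 0 for all t ≥ T and k ≥ ℓ; and for every ℓ there exists c_ℓ > 0 with |g_{ℓ,j}(t)| ≥ c_ℓ for all j ≠ ℓ and t ≥ T. If moreover for every ℓ ∈ ℕ the function t ↦ ‖H'(t)e_ℓ‖ is bounded, then for every ℓ ∈ ℕ, H(t)e_ℓ converges in H, as t → +∞, to h_{ℓ,ℓ}(∞) e_ℓ, where h_{ℓ,ℓ}(∞) = lim_{t→∞} h_{ℓ,ℓ}(t). -/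
open MeasureTheory Filter Set
open scoped RealInnerProductSpace

/-- If the sum of a bounded function's continuous derivative and an integrable function is
nonnegative, then it is integrable. -/
theorem integrableOn_Ioi_deriv_add_of_nonneg {f f' G : ℝ → ℝ} {T K : ℝ}
    (hf : ∀ t, HasDerivAt f (f' t) t) (hf' : Continuous f') (hK : ∀ t, |f t| ≤ K)
    (hG : IntegrableOn G (Ioi T)) (hpos : ∀ t ≥ T, 0 ≤ f' t + G t) :
    IntegrableOn (fun t => f' t + G t) (Ioi T) := by
  refine integrableOn_Ioi_of_intervalIntegral_norm_bounded (l := atTop) (b := id)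
    (2 * K + ∫ t in Ioi T, |G t|) T (fun i => ?_) tendsto_id ?_
  · exact (hf'.integrableOn_Ioc).add (hG.mono_set Ioc_subset_Ioi_self)
  · filter_upwards [eventually_ge_atTop T] with b hb
    have hGb : IntegrableOn G (Ioc T b) := hG.mono_set Ioc_subset_Ioi_self
    have hGi : IntervalIntegrable G volume T b :=
      (intervalIntegrable_iff_integrableOn_Ioc_of_le hb).2 hGb
    have h1 : ∫ t in T..b, ‖f' t + G t‖ = ∫ t in T..b, (f' t + G t) := by
      refine intervalIntegral.integral_congr fun t ht => ?_
      rw [uIcc_of_le hb] at ht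
      exact Real.norm_of_nonneg (hpos t ht.1)
    have h2 : ∫ t in T..b, f' t = f b - f T :=
      intervalIntegral.integral_eq_sub_of_hasDerivAt (fun t _ => hf t)
        (hf'.intervalIntegrable T b)
    have h3 : ∫ t in T..b, G t ≤ ∫ t in Ioi T, |G t| := by
      rw [intervalIntegral.integral_of_le hb]
      calc ∫ t in Ioc T b, G t ≤ ∫ t in Ioc T b, |G t| :=
            integral_mono hGb hGb.abs fun t => le_abs_self _
        _ ≤ ∫ t in Ioi T, |G t| :=
            setIntegral_mono_set hG.abs (Eventually.of_forall fun t => abs_nonneg _)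
              Ioc_subset_Ioi_self.eventuallyLE
    simp only [id_eq]
    rw [h1, intervalIntegral.integral_add (hf'.intervalIntegrable T b) hGi, h2]
    have := abs_le.1 (hK b)
    have := abs_le.1 (hK T)
    linarith

/-- A form of Barbalat's lemma: an integrable bounded function with bounded continuous derivative
tends to zero. -/
theorem tendsto_zero_of_integrableOn_Ioi_of_bounded_deriv {f f' : ℝ → ℝ} {T K K' : ℝ}
    (hf : ∀ t, HasDerivAt f (f' t) t) (hf' : Continuous f') (hK : ∀ t, |f t| ≤ K)
    (hK' : ∀ t, |f' t| ≤ K') (hint : IntegrableOn f (Ioi T)) :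
    Tendsto f atTop (nhds 0) := by
  have hfc : Continuous f := continuous_iff_continuousAt.2 fun t => (hf t).continuousAt
  have hsq : Tendsto (fun t => f t * f t) atTop (nhds 0) := by
    refine tendsto_zero_of_hasDerivAt_of_integrableOn_Ioi (a := T)
      (f' := fun t => f' t * f t + f t * f' t) (fun t _ => (hf t).mul (hf t)) ?_ ?_
    · have h1 : IntegrableOn (fun t => f' t * f t) (Ioi T) :=
        Integrable.bdd_mul hint hf'.aestronglyMeasurable (Eventually.of_forall hK')
      refine h1.add (h1.congr (Eventually.of_forall fun t => ?_))
      exact mul_comm _ _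
    · exact Integrable.bdd_mul hint hfc.aestronglyMeasurable (Eventually.of_forall hK)
  have := hsq.sqrt
  simp only [Real.sqrt_mul_self_eq_abs, Real.sqrt_zero] at this
  exact (tendsto_zero_iff_abs_tendsto_zero f).2 this

/-- If a series has nonnegative terms from the index `n` on, then the sum of the absolute values
is obtained by correcting the first `n` terms. -/
theorem HasSum.abs_of_nonneg_of_ge {f : ℕ → ℝ} {a : ℝ} {n : ℕ} (hf : HasSum f a)
    (hn : ∀ j, n ≤ j → 0 ≤ f j) :
    HasSum (fun j => |f j|) (a + ∑ j ∈ Finset.range n, (|f j| - f j)) := by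
  have h1 : HasSum (fun j => |f j| - f j) (∑ j ∈ Finset.range n, (|f j| - f j)) := by
    refine hasSum_sum_of_ne_finset_zero fun j hj => ?_
    rw [abs_of_nonneg (hn j (by simpa using hj)), sub_self]
  simpa using hf.add h1

/-- A continuously differentiable bounded curve with bounded derivative whose part orthogonal to a
unit vector `v` is square integrable, and whose coordinate along `v` converges, converges. -/
theorem tendsto_smul_of_integrableOn_orthogonal_sq
    {E : Type*} [NormedAddCommGroup E] [InnerProductSpace ℝ E] {v : E} (hv : ‖v‖ = 1)
    {u u' : ℝ → E} {T K K' L : ℝ}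
    (hu : ∀ t, HasDerivAt u (u' t) t) (hu' : Continuous u') (hK : ∀ t, ‖u t‖ ≤ K)
    (hK' : ∀ t, ‖u' t‖ ≤ K')
    (hint : IntegrableOn (fun t => ‖u t‖ ^ 2 - ⟪u t, v⟫ ^ 2) (Ioi T))
    (hL : Tendsto (fun t => ⟪u t, v⟫) atTop (nhds L)) :
    Tendsto u atTop (nhds (L • v)) := by
  have hvv : ⟪v, v⟫ = 1 := by rw [real_inner_self_eq_norm_sq, hv, one_pow]
  have hin : ∀ x : E, |⟪x, v⟫| ≤ ‖x‖ := fun x => by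
    simpa [hv] using abs_real_inner_le_norm x v
  set w : ℝ → E := fun t => u t - ⟪u t, v⟫ • v with hw
  set w' : ℝ → E := fun t => u' t - ⟪u' t, v⟫ • v with hw'
  have hproj : ∀ x : E, ‖x - ⟪x, v⟫ • v‖ ^ 2 = ‖x‖ ^ 2 - ⟪x, v⟫ ^ 2 := fun x => by
    rw [norm_sub_sq_real, inner_smul_right, norm_smul, hv, mul_one, Real.norm_eq_abs, sq_abs]
    ring
  have hprojle : ∀ x : E, ‖x - ⟪x, v⟫ • v‖ ≤ ‖x‖ := fun x => by
    refine le_of_pow_le_pow_left₀ two_ne_zero (norm_nonneg _) ?_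
    rw [hproj]
    linarith [sq_nonneg ⟪x, v⟫]
  have hwd : ∀ t, HasDerivAt w (w' t) t := fun t => by
    have h1 : HasDerivAt (fun t => ⟪u t, v⟫) ⟪u' t, v⟫ t := by
      simpa using (hu t).inner ℝ (hasDerivAt_const t v)
    exact (hu t).sub (h1.smul_const v)
  have hwc' : Continuous w' := by fun_prop
  have hwc : Continuous w := continuous_iff_continuousAt.2 fun t => (hwd t).continuousAt
  have hK0 : 0 ≤ K := (norm_nonneg _).trans (hK 0)
  have hwK : ∀ t, ‖w t‖ ≤ K := fun t => (hprojle _).trans (hK t)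
  have hwK' : ∀ t, ‖w' t‖ ≤ K' := fun t => (hprojle _).trans (hK' t)
  have hφ : Tendsto (fun t => ‖w t‖ ^ 2) atTop (nhds 0) := by
    refine tendsto_zero_of_integrableOn_Ioi_of_bounded_deriv (T := T) (K := K ^ 2)
      (K' := 2 * (K * K')) (fun t => (hwd t).norm_sq) (by fun_prop) (fun t => ?_) (fun t => ?_) ?_
    · rw [abs_of_nonneg (sq_nonneg _)]
      exact pow_le_pow_left₀ (norm_nonneg _) (hwK t) 2
    · rw [abs_mul, abs_two]
      gcongr
      exact (abs_real_inner_le_norm _ _).trans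
        (mul_le_mul (hwK t) (hwK' t) (norm_nonneg _) hK0)
    · simpa only [hw, hproj] using hint
  have hw0 : Tendsto w atTop (nhds 0) := by
    rw [tendsto_zero_iff_norm_tendsto_zero]
    simpa using hφ.sqrt
  simpa [hw] using hw0.add (hL.smul_const v)

/-- main convergence theorem, convergence of columns. Under the hypotheses
of the main theorem together with the semi-uniform lower bound, if moreover for every `ℓ` the
function `t ↦ ‖H'(t) e_ℓ‖` is bounded, then for every `ℓ`, `H(t) e_ℓ` converges in `𝓗`, as
`t → +∞`, to `h_{ℓ,ℓ}(∞) • e_ℓ` where `h_{ℓ,ℓ}(∞) = lim_{t→∞} h ℓ ℓ t`. -/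
theorem stmt4
    {𝓗 : Type*} [NormedAddCommGroup 𝓗] [InnerProductSpace ℝ 𝓗] [CompleteSpace 𝓗]
    (e : HilbertBasis ℕ ℝ 𝓗)
    (H H' : ℝ → 𝓗 →L[ℝ] 𝓗)
    (hC1 : ∀ t : ℝ, HasDerivAt H (H' t) t) (hC1' : Continuous H')
    (hHS : ∀ t : ℝ, Summable fun n => ‖H t (e n)‖ ^ 2)
    (hHSbdd : ∃ M : ℝ, ∀ t : ℝ, (∑' n, ‖H t (e n)‖ ^ 2) ≤ M)
    (h : ℕ → ℕ → ℝ → ℝ)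
    (hdef : ∀ i j t, h i j t = ⟪H t (e i), e j⟫)
    (hbal : ∀ i j : ℕ, ∃ c : ℝ → ℝ, Measurable c ∧ (∃ B : ℝ, ∀ t, 0 ≤ c t ∧ c t ≤ B) ∧
      ∀ t, |h i j t| ≤ c t * |h j i t|)
    (g : ℕ → ℕ → ℝ → ℝ)
    (hgmeas : ∀ i j, Measurable (g i j))
    (hgptbdd : ∀ t : ℝ, ∃ M : ℝ, ∀ i j, |g i j t| ≤ M)
    (hgbal : ∀ i j : ℕ, ∃ c : ℝ → ℝ, Measurable c ∧ (∃ B : ℝ, ∀ t, 0 ≤ c t ∧ c t ≤ B) ∧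
      ∀ t, |g i j t| ≤ c t * |g j i t|)
    (hODE : ∀ i : ℕ, ∀ t : ℝ, HasSum (fun j => g i j t * (h i j t) ^ 2) (deriv (h i i) t))
    (T : ℝ) (hT : 0 < T)
    (ε : ℕ → ℝ) (hε : ∀ ℓ, ε ℓ = 1 ∨ ε ℓ = -1)
    (hsign : ∀ t ≥ T, ∀ k ℓ : ℕ, ℓ ≤ k → 0 ≤ ε ℓ * g ℓ k t)
    (hlow : ∀ ℓ : ℕ, ∃ c : ℝ, 0 < c ∧ ∀ j : ℕ, j ≠ ℓ → ∀ t ≥ T, c ≤ |g ℓ j t|)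
    (hH'bdd : ∀ ℓ : ℕ, ∃ M : ℝ, ∀ t : ℝ, ‖H' t (e ℓ)‖ ≤ M) :
    ∀ ℓ : ℕ, ∃ L : ℝ,
      Tendsto (fun t => h ℓ ℓ t) atTop (nhds L) ∧
      Tendsto (fun t => H t (e ℓ)) atTop (nhds (L • e ℓ)) := by
  obtain ⟨M, hM⟩ := hHSbdd
  have hcol : ∀ ℓ t, ‖H t (e ℓ)‖ ≤ √M := fun ℓ t =>
    Real.le_sqrt_of_sq_le (((hHS t).le_tsum ℓ fun _ _ => sq_nonneg _).trans (hM t))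
  have he : ∀ ℓ, ‖e ℓ‖ = 1 := fun ℓ => e.orthonormal.1 ℓ
  have hud : ∀ ℓ t, HasDerivAt (fun t => H t (e ℓ)) (H' t (e ℓ)) t := fun ℓ t => by
    simpa using (hC1 t).clm_apply (hasDerivAt_const t (e ℓ))
  have huc' : ∀ ℓ, Continuous fun t => H' t (e ℓ) := fun ℓ => by fun_prop
  have hhfun : ∀ i j, h i j = fun t => ⟪H t (e i), e j⟫ := fun i j => funext (hdef i j)
  have hhd : ∀ i j t, HasDerivAt (h i j) ⟪H' t (e i), e j⟫ t := fun i j t => by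
    rw [hhfun]
    simpa using (hud i t).inner ℝ (hasDerivAt_const t (e j))
  have hhc : ∀ i j, Continuous (h i j) := fun i j =>
    continuous_iff_continuousAt.2 fun t => (hhd i j t).continuousAt
  have hhK : ∀ ℓ t, |h ℓ ℓ t| ≤ √M := fun ℓ t => by
    rw [hdef]
    have := abs_real_inner_le_norm (H t (e ℓ)) (e ℓ)
    rw [he, mul_one] at this
    exact this.trans (hcol ℓ t)
  have habsε : ∀ ℓ, |ε ℓ| = 1 := fun ℓ => by rcases hε ℓ with h1 | h1 <;> simp [h1]
  have hfm : ∀ i j, Measurable fun t => g i j t * h i j t ^ 2 := fun i j =>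
    (hgmeas i j).mul ((hhc i j).measurable.pow_const 2)
  set G : ℕ → ℝ → ℝ := fun ℓ t => ∑ j ∈ Finset.range ℓ,
    (|ε ℓ * (g ℓ j t * h ℓ j t ^ 2)| - ε ℓ * (g ℓ j t * h ℓ j t ^ 2)) with hGdef
  set Q : ℕ → ℝ → ℝ := fun ℓ t => ε ℓ * ⟪H' t (e ℓ), e ℓ⟫ + G ℓ t with hQdef
  have hQsum : ∀ ℓ, ∀ t ≥ T, HasSum (fun j => |g ℓ j t * h ℓ j t ^ 2|) (Q ℓ t) := by
    intro ℓ t ht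
    have h1 := (hODE ℓ t).mul_left (ε ℓ)
    rw [(hhd ℓ ℓ t).deriv] at h1
    have h2 := h1.abs_of_nonneg_of_ge (n := ℓ) fun j hj => by
      rw [← mul_assoc]
      exact mul_nonneg (hsign t ht j ℓ hj) (sq_nonneg _)
    simpa only [hQdef, hGdef, abs_mul (ε ℓ), habsε, one_mul] using h2
  have hGint : ∀ ℓ, (∀ j < ℓ, IntegrableOn (fun t => g ℓ j t * h ℓ j t ^ 2) (Ioi T)) →
      IntegrableOn (G ℓ) (Ioi T) := fun ℓ hℓ =>
    integrable_finsetSum _ fun j hj =>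
      have h1 := (hℓ j (Finset.mem_range.1 hj)).const_mul (ε ℓ)
      h1.abs.sub h1
  have hQint : ∀ ℓ, IntegrableOn (G ℓ) (Ioi T) → IntegrableOn (Q ℓ) (Ioi T) := by
    intro ℓ hG
    refine integrableOn_Ioi_deriv_add_of_nonneg (K := √M)
      (fun t => (hhd ℓ ℓ t).const_mul (ε ℓ)) (by fun_prop) (fun t => ?_) hG
      fun t ht => (hQsum ℓ t ht).nonneg fun _ => abs_nonneg _
    rw [abs_mul, habsε, one_mul]
    exact hhK ℓ t
  have hterm : ∀ ℓ j, IntegrableOn (Q ℓ) (Ioi T) →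
      IntegrableOn (fun t => g ℓ j t * h ℓ j t ^ 2) (Ioi T) := by
    intro ℓ j hQ
    refine Integrable.mono' hQ (hfm ℓ j).aestronglyMeasurable ?_
    filter_upwards [ae_restrict_mem measurableSet_Ioi] with t ht
    exact le_hasSum (hQsum ℓ t (le_of_lt ht)) j fun _ _ => abs_nonneg _
  have hswap : ∀ i j, IntegrableOn (fun t => g i j t * h i j t ^ 2) (Ioi T) →
      IntegrableOn (fun t => g j i t * h j i t ^ 2) (Ioi T) := by
    intro i j hij
    obtain ⟨c, -, ⟨B, hB⟩, hc⟩ := hbal j i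
    obtain ⟨d, -, ⟨D, hD⟩, hd⟩ := hgbal j i
    refine Integrable.mono' (hij.abs.const_mul (D * B ^ 2)) (hfm j i).aestronglyMeasurable
      (Eventually.of_forall fun t => ?_)
    have h1 : |g j i t| ≤ D * |g i j t| :=
      (hd t).trans (mul_le_mul_of_nonneg_right (hD t).2 (abs_nonneg _))
    have h2 : |h j i t| ≤ B * |h i j t| :=
      (hc t).trans (mul_le_mul_of_nonneg_right (hB t).2 (abs_nonneg _))
    rw [Real.norm_eq_abs, abs_mul, abs_mul, abs_pow, abs_pow]
    calc |g j i t| * |h j i t| ^ 2 ≤ (D * |g i j t|) * (B * |h i j t|) ^ 2 := by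
          gcongr
          exact (abs_nonneg _).trans h1
      _ = D * B ^ 2 * (|g i j t| * |h i j t| ^ 2) := by ring
  have hGall : ∀ ℓ, IntegrableOn (G ℓ) (Ioi T) := by
    intro ℓ
    induction ℓ using Nat.strong_induction_on with
    | _ ℓ ih => exact hGint ℓ fun j hj => hswap j ℓ (hterm j ℓ (hQint j (ih j hj)))
  intro ℓ
  have hQ := hQint ℓ (hGall ℓ)
  have hderint : IntegrableOn (fun t => ⟪H' t (e ℓ), e ℓ⟫) (Ioi T) := by
    have h1 : IntegrableOn (fun t => ε ℓ * (Q ℓ t - G ℓ t)) (Ioi T) :=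
      (hQ.sub (hGall ℓ)).const_mul (ε ℓ)
    refine h1.congr (Eventually.of_forall fun t => ?_)
    have h2 : ε ℓ * ε ℓ = 1 := by rcases hε ℓ with h1 | h1 <;> simp [h1]
    simp only [hQdef, add_sub_cancel_right]
    rw [← mul_assoc, h2, one_mul]
  have hL := tendsto_limUnder_of_hasDerivAt_of_integrableOn_Ioi
    (fun t _ => hhd ℓ ℓ t) hderint
  refine ⟨_, hL, ?_⟩
  obtain ⟨K', hK'⟩ := hH'bdd ℓ
  obtain ⟨c, hc, hlow⟩ := hlow ℓ
  refine tendsto_smul_of_integrableOn_orthogonal_sq (he ℓ) (T := T) (hud ℓ) (huc' ℓ) (hcol ℓ) hK'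
    ?_ (hL.congr (hdef ℓ ℓ))
  have hHc : Continuous fun t => H t (e ℓ) :=
    continuous_iff_continuousAt.2 fun t => (hud ℓ t).continuousAt
  refine Integrable.mono' (hQ.const_mul c⁻¹)
    (by fun_prop : Continuous _).aestronglyMeasurable ?_
  filter_upwards [ae_restrict_mem measurableSet_Ioi] with t ht
  have hpars : HasSum (fun j => h ℓ j t ^ 2) (‖H t (e ℓ)‖ ^ 2) := by
    have h1 := e.hasSum_inner_mul_inner (H t (e ℓ)) (H t (e ℓ))
    rw [real_inner_self_eq_norm_sq] at h1
    have h2 : (fun j => h ℓ j t ^ 2) = fun j => ⟪H t (e ℓ), e j⟫ * ⟪e j, H t (e ℓ)⟫ := by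
      funext j
      rw [hdef, sq, real_inner_comm (e j)]
    rwa [h2]
  have hoff := hpars.sub (hasSum_ite_eq ℓ (h ℓ ℓ t ^ 2))
  rw [← hdef]
  rw [Real.norm_of_nonneg (hoff.nonneg fun j => ?_)]
  · refine hasSum_le (fun j => ?_) hoff ((hQsum ℓ t (le_of_lt ht)).mul_left c⁻¹)
    rcases eq_or_ne j ℓ with rfl | hj
    · rw [if_pos rfl, sub_self]
      exact mul_nonneg (inv_nonneg.2 hc.le) (abs_nonneg _)
    · rw [if_neg hj, sub_zero, abs_mul, abs_of_nonneg (sq_nonneg (h ℓ j t)), le_inv_mul_iff₀ hc]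
      exact mul_le_mul_of_nonneg_right (hlow j hj t (le_of_lt ht)) (sq_nonneg _)
  · by_cases hj : j = ℓ
    · simp [hj]
    · simp [hj, sq_nonneg]
end

section
/- Let H be a real Hilbert space of finite dimension d and let G : S(H) → A(H) be a linear diagonalizable map whose constant matrix-eigenvalue (g_{i,j})_{0≤i,j≤d−1} satisfies: there exist signs (ε_ℓ) ∈ {−1,1}^d with ε_ℓ g_{ℓ,k} ≥ 0 for all k ≥ ℓ, and for every ℓ, g_{ℓ,j} ≠ 0 for all j ≠ ℓ. Then for every symmetric H₀ the solution of H' = [H, G(H)], H(0) = H₀, converges in operator norm as t → +∞ to a diagonal operator H_∞ = diag(α_ℓ)_{0≤ℓ≤d−1}, and the numbers α₀,…,α_{d−1} are exactly the eigenvalues of H₀ counted with multiplicity. -/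
open MeasureTheory Filter Set ContinuousLinearMap
open scoped RealInnerProductSpace

/-- The rank-one operator `x ↦ ⟪u, x⟫ • v`, i.e. `u*(·) v`. -/
noncomputable def rankOne {𝓗 : Type*} [NormedAddCommGroup 𝓗] [InnerProductSpace ℝ 𝓗]
    (u v : 𝓗) : 𝓗 →L[ℝ] 𝓗 :=
  (innerSL ℝ u).smulRight v

/-- The symmetric family `E_{i,j}` in finite dimension. -/
noncomputable def EsymF {𝓗 : Type*} [NormedAddCommGroup 𝓗] [InnerProductSpace ℝ 𝓗]
    {d : ℕ} (e : OrthonormalBasis (Fin d) ℝ 𝓗) (i j : Fin d) : 𝓗 →L[ℝ] 𝓗 :=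
  if i = j then rankOne (e i) (e i)
  else (Real.sqrt 2)⁻¹ • (rankOne (e j) (e i) + rankOne (e i) (e j))

/-- The skew-symmetric family `E±_{i,j}` in finite dimension. -/
noncomputable def EskewF {𝓗 : Type*} [NormedAddCommGroup 𝓗] [InnerProductSpace ℝ 𝓗]
    {d : ℕ} (e : OrthonormalBasis (Fin d) ℝ 𝓗) (i j : Fin d) : 𝓗 →L[ℝ] 𝓗 :=
  (Real.sqrt 2)⁻¹ • (rankOne (e j) (e i) - rankOne (e i) (e j))

theorem exists_tendsto_of_hasDerivWithinAt_nonpos {V V' : ℝ → ℝ} {m : ℝ}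
    (hV : ∀ t ∈ Ici (0 : ℝ), HasDerivWithinAt V (V' t) (Ici 0) t)
    (hV' : ∀ t ∈ Ici (0 : ℝ), V' t ≤ 0) (hm : ∀ t ∈ Ici (0 : ℝ), m ≤ V t) :
    ∃ L, Tendsto V atTop (nhds L) := by
  have hanti : AntitoneOn V (Ici 0) :=
    antitoneOn_of_hasDerivWithinAt_nonpos (convex_Ici 0) (fun t ht => (hV t ht).continuousWithinAt)
      (fun t ht => (hV t (interior_subset ht)).mono interior_subset)
      (fun t ht => hV' t (interior_subset ht))
  have hanti' : Antitone fun t => V (max t 0) := fun s t hst =>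
    hanti (le_max_right s 0) (le_max_right t 0) (max_le_max_right 0 hst)
  have hbdd : BddBelow (range fun t => V (max t 0)) :=
    ⟨m, by rintro _ ⟨t, rfl⟩; exact hm _ (le_max_right t 0)⟩
  refine ⟨_, (tendsto_atTop_ciInf hanti' hbdd).congr' ?_⟩
  filter_upwards [eventually_ge_atTop 0] with t ht
  rw [max_eq_left ht]

theorem exists_tendsto_of_abs_deriv_le {u u' V V' : ℝ → ℝ} {C R m : ℝ} (hC : 0 ≤ C)
    (hu : ∀ t ∈ Ici (0 : ℝ), HasDerivWithinAt u (u' t) (Ici 0) t)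
    (hV : ∀ t ∈ Ici (0 : ℝ), HasDerivWithinAt V (V' t) (Ici 0) t)
    (hV' : ∀ t ∈ Ici (0 : ℝ), V' t ≤ 0)
    (huV : ∀ t ∈ Ici (0 : ℝ), |u' t| ≤ C * -V' t)
    (hR : ∀ t ∈ Ici (0 : ℝ), R ≤ u t) (hm : ∀ t ∈ Ici (0 : ℝ), m ≤ V t) :
    ∃ L, Tendsto u atTop (nhds L) := by
  obtain ⟨L, hL⟩ := exists_tendsto_of_hasDerivWithinAt_nonpos hV hV' hm
  obtain ⟨L', hL'⟩ := exists_tendsto_of_hasDerivWithinAt_nonpos (m := R + C * m)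
    (fun t ht => (hu t ht).add ((hV t ht).const_mul C))
    (fun t ht => by linarith [le_abs_self (u' t), huV t ht])
    (fun t ht => add_le_add (hR t ht) (mul_le_mul_of_nonneg_left (hm t ht) hC))
  exact ⟨L' - C * L, (hL'.sub (hL.const_mul C)).congr fun t => by simp⟩

theorem nonpos_of_tendsto_of_deriv_le_neg {f V V' : ℝ → ℝ} {L m : ℝ}
    (hV : ∀ t ∈ Ici (0 : ℝ), HasDerivWithinAt V (V' t) (Ici 0) t)
    (hm : ∀ t ∈ Ici (0 : ℝ), m ≤ V t)
    (hf : ∀ t ∈ Ici (0 : ℝ), V' t ≤ -f t) (hL : Tendsto f atTop (nhds L)) : L ≤ 0 := by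
  by_contra! hpos
  obtain ⟨T, hT⟩ := eventually_atTop.1
    ((hL.eventually (lt_mem_nhds (half_lt_self hpos))).and (eventually_ge_atTop 0))
  have hT0 : 0 ≤ T := (hT T le_rfl).2
  have hsub : Ici T ⊆ Ici (0 : ℝ) := Ici_subset_Ici.2 hT0
  have hderiv : ∀ t ∈ Ici T,
      HasDerivWithinAt (fun t => V t + L / 2 * t) (V' t + L / 2 * 1) (Ici T) t := fun t ht =>
    ((hV t (hsub ht)).mono hsub).add ((hasDerivWithinAt_id t _).const_mul _)
  have hanti : AntitoneOn (fun t => V t + L / 2 * t) (Ici T) :=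
    antitoneOn_of_hasDerivWithinAt_nonpos (convex_Ici T)
      (fun t ht => (hderiv t ht).continuousWithinAt)
      (fun t ht => (hderiv t (interior_subset ht)).mono interior_subset)
      (fun t ht => by
        have ht' := interior_subset ht
        linarith [hf t (hsub ht'), (hT t ht').1])
  have hVT : 0 ≤ V T - m := sub_nonneg.2 (hm T hT0)
  have hs : T ≤ T + ((V T - m) / (L / 2) + 1) := by
    have : 0 ≤ (V T - m) / (L / 2) := by positivity
    linarith
  have h1 : V (T + ((V T - m) / (L / 2) + 1)) + L / 2 * (T + ((V T - m) / (L / 2) + 1))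
      ≤ V T + L / 2 * T := hanti self_mem_Ici hs hs
  have h2 : L / 2 * ((V T - m) / (L / 2)) = V T - m := mul_div_cancel₀ _ (by positivity)
  have h3 := hm _ (hT0.trans hs)
  linarith

theorem lyapunov_weight_le {d : ℕ} {g : Fin d → Fin d → ℝ} (hgskew : ∀ i j, g j i = -g i j)
    {ε : Fin d → ℝ} (hε : ∀ ℓ, ε ℓ = 1 ∨ ε ℓ = -1)
    (hsign : ∀ k ℓ : Fin d, ℓ ≤ k → 0 ≤ ε ℓ * g ℓ k) (i k : Fin d) :
    |g i k| ≤ (((d : ℝ) - i) * ε i - ((d : ℝ) - k) * ε k) * g i k := by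
  have key : ∀ i k : Fin d, i < k →
      |g i k| ≤ (((d : ℝ) - i) * ε i - ((d : ℝ) - k) * ε k) * g i k := by
    intro i k hik
    have h1 : ε i * g i k = |g i k| := by
      rw [← abs_of_nonneg (hsign k i hik.le), abs_mul]
      rcases hε i with h | h <;> simp [h]
    have h2 : ε k * g i k ≤ |g i k| := by
      refine (le_abs_self _).trans_eq ?_
      rw [abs_mul]
      rcases hε k with h | h <;> simp [h]
    have h3 : (i : ℝ) + 1 ≤ k := by exact_mod_cast hik
    have h4 : (k : ℝ) ≤ d := by exact_mod_cast k.2.le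
    nlinarith [abs_nonneg (g i k), mul_le_mul_of_nonneg_left h2 (sub_nonneg.2 h4),
      mul_le_mul_of_nonneg_right h3 (abs_nonneg (g i k))]
  rcases lt_trichotomy i k with h | rfl | h
  · exact key i k h
  · have : g i i = 0 := by linarith [hgskew i i]
    simp [this]
  · have := key k i h
    rw [hgskew i k, abs_neg] at this
    linarith

theorem tendsto_entries {d : ℕ} {g : Fin d → Fin d → ℝ} (hgskew : ∀ i j, g j i = -g i j)
    {ε : Fin d → ℝ} (hε : ∀ ℓ, ε ℓ = 1 ∨ ε ℓ = -1)
    (hsign : ∀ k ℓ : Fin d, ℓ ≤ k → 0 ≤ ε ℓ * g ℓ k)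
    (hnonzero : ∀ ℓ j : Fin d, j ≠ ℓ → g ℓ j ≠ 0)
    {x : ℝ → Fin d → Fin d → ℝ} {R : ℝ}
    (hsym : ∀ t ∈ Ici (0 : ℝ), ∀ i j, x t i j = x t j i)
    (hR : ∀ t ∈ Ici (0 : ℝ), ∀ i j, |x t i j| ≤ R)
    (hx : ∀ t ∈ Ici (0 : ℝ), ∀ i j, HasDerivWithinAt (fun t => x t i j)
      (∑ k, (x t i k * (g k j * x t k j) - g i k * x t i k * x t k j)) (Ici 0) t) :
    (∀ i, ∃ L, Tendsto (fun t => x t i i) atTop (nhds L)) ∧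
      ∀ i j, i ≠ j → Tendsto (fun t => x t i j) atTop (nhds 0) := by
  set c : Fin d → ℝ := fun i => ((d : ℝ) - i) * ε i with hc
  set W : ℝ → ℝ := fun t => ∑ i, ∑ k, |g i k| * x t i k ^ 2 with hW
  have hdiag : ∀ t ∈ Ici (0 : ℝ), ∀ i,
      ∑ k, (x t i k * (g k i * x t k i) - g i k * x t i k * x t k i)
        = -2 * ∑ k, g i k * x t i k ^ 2 := by
    intro t ht i
    rw [Finset.mul_sum]
    refine Finset.sum_congr rfl fun k _ => ?_
    rw [hsym t ht k i, hgskew i k]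
    ring
  have hV : ∀ t ∈ Ici (0 : ℝ), HasDerivWithinAt (fun t => ∑ i, c i * x t i i)
      (∑ i, c i * (-2 * ∑ k, g i k * x t i k ^ 2)) (Ici 0) t := fun t ht =>
    HasDerivWithinAt.fun_sum fun i _ => by
      rw [← hdiag t ht i]
      exact (hx t ht i i).const_mul _
  have hVW : ∀ t ∈ Ici (0 : ℝ), ∑ i, c i * (-2 * ∑ k, g i k * x t i k ^ 2) ≤ -W t := by
    intro t ht
    have h1 : ∑ i, c i * (-2 * ∑ k, g i k * x t i k ^ 2)
        = -2 * ∑ i, ∑ k, c i * g i k * x t i k ^ 2 := by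
      simp only [Finset.mul_sum]
      exact Finset.sum_congr rfl fun i _ => Finset.sum_congr rfl fun k _ => by ring
    have h2 : ∑ i, ∑ k, c i * g i k * x t i k ^ 2 = ∑ i, ∑ k, -(c k * g i k * x t i k ^ 2) := by
      rw [Finset.sum_comm]
      refine Finset.sum_congr rfl fun i _ => Finset.sum_congr rfl fun k _ => ?_
      rw [hsym t ht k i, hgskew i k]
      ring
    have h3 : W t ≤ ∑ i, ∑ k, (c i * g i k * x t i k ^ 2 + -(c k * g i k * x t i k ^ 2)) := by
      refine Finset.sum_le_sum fun i _ => Finset.sum_le_sum fun k _ => ?_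
      have := mul_le_mul_of_nonneg_right (lyapunov_weight_le hgskew hε hsign i k)
        (sq_nonneg (x t i k))
      simp only [hc]
      linarith
    simp only [Finset.sum_add_distrib] at h3
    linarith
  have hW0 : ∀ t, 0 ≤ W t := fun t => by positivity
  have hWi : ∀ t i, ∑ k, |g i k| * x t i k ^ 2 ≤ W t := fun t i =>
    Finset.single_le_sum (f := fun i => ∑ k, |g i k| * x t i k ^ 2)
      (fun i _ => by positivity) (Finset.mem_univ i)
  have hWij : ∀ t i j, |g i j| * x t i j ^ 2 ≤ W t := fun t i j =>
    (Finset.single_le_sum (f := fun j => |g i j| * x t i j ^ 2)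
      (fun j _ => by positivity) (Finset.mem_univ j)).trans (hWi t i)
  have hV0 : ∀ t ∈ Ici (0 : ℝ), ∑ i, c i * (-2 * ∑ k, g i k * x t i k ^ 2) ≤ 0 := fun t ht =>
    (hVW t ht).trans (neg_nonpos.2 (hW0 t))
  have hVm : ∀ t ∈ Ici (0 : ℝ), -∑ i, |c i| * R ≤ ∑ i, c i * x t i i := by
    intro t ht
    refine neg_le_of_abs_le ((Finset.abs_sum_le_sum_abs _ _).trans
      (Finset.sum_le_sum fun i _ => ?_))
    rw [abs_mul]
    exact mul_le_mul_of_nonneg_left (hR t ht i i) (abs_nonneg _)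
  refine ⟨fun i => ?_, fun i j hij => ?_⟩
  · refine exists_tendsto_of_abs_deriv_le zero_le_two (fun t ht => hx t ht i i) hV hV0
      (fun t ht => ?_) (fun t ht => neg_le_of_abs_le (hR t ht i i)) hVm
    rw [hdiag t ht i, abs_mul, abs_neg, abs_two]
    refine mul_le_mul_of_nonneg_left ?_ zero_le_two
    refine (Finset.abs_sum_le_sum_abs _ _).trans ?_
    have h1 : ∑ k, |g i k * x t i k ^ 2| = ∑ k, |g i k| * x t i k ^ 2 := by simp [abs_mul]
    linarith [hWi t i, hVW t ht]
  · have hgij : 0 < |g i j| := abs_pos.2 (hnonzero i j hij.symm)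
    have hR0 : 0 ≤ R := (abs_nonneg _).trans (hR 0 self_mem_Ici i j)
    set M : ℝ := ∑ k, (R * (|g k j| * R) + |g i k| * R * R) with hM
    have hM0 : 0 ≤ M := by positivity
    have hx'M : ∀ t ∈ Ici (0 : ℝ),
        |∑ k, (x t i k * (g k j * x t k j) - g i k * x t i k * x t k j)| ≤ M := by
      intro t ht
      refine (Finset.abs_sum_le_sum_abs _ _).trans (Finset.sum_le_sum fun k _ => ?_)
      refine (abs_sub _ _).trans ?_
      simp only [abs_mul]
      have := hR t ht i k
      have := hR t ht k j
      gcongr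
    obtain ⟨L, hL⟩ : ∃ L, Tendsto (fun t => x t i j ^ 4) atTop (nhds L) := by
      refine exists_tendsto_of_abs_deriv_le (C := 4 * R * M / |g i j|) (R := 0) (by positivity)
        (fun t ht => (hx t ht i j).pow 4) hV hV0 (fun t ht => ?_)
        (fun t _ => by positivity) hVm
      have h1 : x t i j ^ 2 ≤ (-∑ i, c i * (-2 * ∑ k, g i k * x t i k ^ 2)) / |g i j| := by
        rw [le_div_iff₀ hgij]
        linarith [hWij t i j, hVW t ht]
      have h2 := hx'M t ht
      have h3 := hR t ht i j
      calc _ = 4 * |x t i j| * |∑ k, (x t i k * (g k j * x t k j) - g i k * x t i k * x t k j)|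
              * x t i j ^ 2 := by
            rw [← sq_abs (x t i j)]
            simp only [abs_mul, abs_pow, Nat.cast_ofNat, Nat.abs_ofNat, Nat.add_one_sub_one]
            ring
        _ ≤ 4 * R * M * ((-∑ i, c i * (-2 * ∑ k, g i k * x t i k ^ 2)) / |g i j|) := by gcongr
        _ = _ := by ring
    have hsq : Tendsto (fun t => x t i j ^ 2) atTop (nhds √L) := by
      refine hL.sqrt.congr fun t => ?_
      rw [show x t i j ^ 4 = (x t i j ^ 2) ^ 2 by ring, Real.sqrt_sq (sq_nonneg _)]
    have hL0 : |g i j| * √L ≤ 0 := nonpos_of_tendsto_of_deriv_le_neg hV hVm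
      (fun t ht => (hVW t ht).trans (neg_le_neg (hWij t i j))) (hsq.const_mul _)
    have hL1 : √L = 0 :=
      le_antisymm (nonpos_of_mul_nonpos_right hL0 hgij) (Real.sqrt_nonneg _)
    rw [hL1] at hsq
    rw [tendsto_zero_iff_abs_tendsto_zero]
    simpa [Real.sqrt_sq_eq_abs, Function.comp_def] using hsq.sqrt

theorem exists_perm_of_sum_pow_eq {ι : Type*} [Fintype ι] {α β : ι → ℝ}
    (h : ∀ n : ℕ, ∑ i, α i ^ n = ∑ i, β i ^ n) : ∃ σ : Equiv.Perm ι, ∀ i, β (σ i) = α i := by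
  classical
  have hpoly : ∀ p : Polynomial ℝ, ∑ i, p.eval (α i) = ∑ i, p.eval (β i) := by
    intro p
    simp only [Polynomial.eval_eq_sum_range]
    rw [Finset.sum_comm, Finset.sum_comm (s := Finset.univ)]
    simp only [← Finset.mul_sum, h]
  have hcard : ∀ y, Fintype.card {i // α i = y} = Fintype.card {i // β i = y} := by
    intro y
    set S := (Finset.univ.image α ∪ Finset.univ.image β).erase y with hS
    set p : Polynomial ℝ := ∏ z ∈ S, (Polynomial.X - Polynomial.C z) with hp
    have hpy : p.eval y ≠ 0 := by
      rw [hp, Polynomial.eval_prod, Finset.prod_ne_zero_iff]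
      intro z hz
      simpa [sub_eq_zero] using (Finset.ne_of_mem_erase hz).symm
    have hp0 : ∀ z ∈ S, p.eval z = 0 := by
      intro z hz
      rw [hp, Polynomial.eval_prod]
      exact Finset.prod_eq_zero hz (by simp)
    have hα : ∀ i, p.eval (α i) = if α i = y then p.eval y else 0 := by
      intro i
      split_ifs with hi
      · rw [hi]
      · exact hp0 _ (by simp [hS, hi])
    have hβ : ∀ i, p.eval (β i) = if β i = y then p.eval y else 0 := by
      intro i
      split_ifs with hi
      · rw [hi]
      · exact hp0 _ (by simp [hS, hi])
    have := hpoly p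
    simp only [hα, hβ, ← Finset.sum_filter, Finset.sum_const, nsmul_eq_mul] at this
    rw [Fintype.card_subtype, Fintype.card_subtype]
    exact_mod_cast mul_right_cancel₀ hpy this
  refine ⟨(Equiv.sigmaFiberEquiv α).symm.trans
    ((Equiv.sigmaCongrRight fun y => Fintype.equivOfCardEq (hcard y)).trans
      (Equiv.sigmaFiberEquiv β)), fun i => ?_⟩
  exact (Fintype.equivOfCardEq (hcard (α i)) ⟨i, rfl⟩).2

section LaxPair

variable {𝓗 : Type*} [NormedAddCommGroup 𝓗] [InnerProductSpace ℝ 𝓗]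

theorem hasDerivWithinAt_pow_of_commutator {𝓐 : Type*} [NormedRing 𝓐] [NormedAlgebra ℝ 𝓐]
    {H : ℝ → 𝓐} {B : 𝓐} {s : Set ℝ} {t : ℝ}
    (hH : HasDerivWithinAt H (H t * B - B * H t) s t) (n : ℕ) :
    HasDerivWithinAt (fun t => H t ^ n) (H t ^ n * B - B * H t ^ n) s t := by
  induction n with
  | zero => simpa using hasDerivWithinAt_const t s (1 : 𝓐)
  | succ n ih =>
    simp only [pow_succ]
    refine (ih.mul hH).congr_deriv ?_
    noncomm_ring

theorem trace_pow_eq_sum {d : ℕ} (b : OrthonormalBasis (Fin d) ℝ 𝓗) {A : 𝓗 →L[ℝ] 𝓗}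
    {μ : Fin d → ℝ} (hA : ∀ i, A (b i) = μ i • b i) (n : ℕ) :
    LinearMap.trace ℝ 𝓗 ((A ^ n : 𝓗 →L[ℝ] 𝓗) : 𝓗 →ₗ[ℝ] 𝓗) = ∑ i, μ i ^ n := by
  have hpow : ∀ i, (A ^ n) (b i) = μ i ^ n • b i := by
    intro i
    induction n with
    | zero => simp
    | succ n ih => rw [pow_succ, mul_apply_eq_comp, hA, map_smul, ih, smul_smul, pow_succ']
  rw [LinearMap.trace_eq_sum_inner _ b]
  simp only [ContinuousLinearMap.coe_coe, hpow, inner_smul_right]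
  simp

theorem rankOne_apply (u v x : 𝓗) : rankOne u v x = ⟪u, x⟫ • v := rfl

theorem rankOne_add_rankOne_swap {d : ℕ} (e : OrthonormalBasis (Fin d) ℝ 𝓗) (i j : Fin d) :
    rankOne (e j) (e i) + rankOne (e i) (e j) =
      (if i = j then 2 else √2 : ℝ) • EsymF e i j := by
  unfold EsymF
  split_ifs with h
  · rw [h, two_smul]
  · rw [smul_smul, mul_inv_cancel₀ (by positivity), one_smul]

theorem rankOne_sub_rankOne_swap {d : ℕ} (e : OrthonormalBasis (Fin d) ℝ 𝓗) (i j : Fin d) :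
    rankOne (e j) (e i) - rankOne (e i) (e j) =
      (if i = j then 2 else √2 : ℝ) • EskewF e i j := by
  unfold EskewF
  split_ifs with h
  · simp [h]
  · rw [smul_smul, mul_inv_cancel₀ (by positivity), one_smul]

theorem sum_inner_smul_rankOne {d : ℕ} (e : OrthonormalBasis (Fin d) ℝ 𝓗) (A : 𝓗 →L[ℝ] 𝓗) :
    ∑ i, ∑ j, ⟪e i, A (e j)⟫ • rankOne (e j) (e i) = A := by
  ext x
  simp only [sum_apply, smul_apply, rankOne_apply]
  conv_rhs => rw [← e.sum_repr' (A x)]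
  refine Finset.sum_congr rfl fun i _ => ?_
  conv_rhs => rw [← e.sum_repr' x, map_sum, inner_sum, Finset.sum_smul]
  refine Finset.sum_congr rfl fun j _ => ?_
  rw [map_smul, inner_smul_right, smul_smul, mul_comm]

theorem inner_map_apply_eq {d : ℕ} (e : OrthonormalBasis (Fin d) ℝ 𝓗)
    (G : (𝓗 →L[ℝ] 𝓗) →ₗ[ℝ] (𝓗 →L[ℝ] 𝓗)) {g : Fin d → Fin d → ℝ} (hgskew : ∀ i j, g j i = -g i j)
    (hG : ∀ i j, G (EsymF e i j) = g i j • EskewF e i j) {A : 𝓗 →L[ℝ] 𝓗}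
    (hA : ∀ i j, ⟪e i, A (e j)⟫ = ⟪e j, A (e i)⟫) (k l : Fin d) :
    ⟪e k, G A (e l)⟫ = g k l * ⟪e k, A (e l)⟫ := by
  have h2 : (2 : ℝ) • A =
      ∑ i, ∑ j, ⟪e i, A (e j)⟫ • (rankOne (e j) (e i) + rankOne (e i) (e j)) := by
    simp only [smul_add, Finset.sum_add_distrib, two_smul]
    congr 1
    · exact (sum_inner_smul_rankOne e A).symm
    · rw [Finset.sum_comm]
      simp only [hA]
      conv_lhs => rw [← sum_inner_smul_rankOne e A]
  have hG2 : ∀ i j, G (rankOne (e j) (e i) + rankOne (e i) (e j)) =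
      g i j • (rankOne (e j) (e i) - rankOne (e i) (e j)) := by
    intro i j
    rw [rankOne_add_rankOne_swap, rankOne_sub_rankOne_swap, map_smul, hG, smul_comm]
  have h3 : 2 * ⟪e k, G A (e l)⟫ = 2 * (g k l * ⟪e k, A (e l)⟫) := by
    calc 2 * ⟪e k, G A (e l)⟫ = ⟪e k, G ((2 : ℝ) • A) (e l)⟫ := by
          rw [map_smul, smul_apply, inner_smul_right]
      _ = ∑ i, ∑ j, ⟪e i, A (e j)⟫ * (g i j * ((if k = i then if j = l then 1 else 0 else 0)
            - (if k = j then if i = l then 1 else 0 else 0))) := by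
          rw [h2]
          simp only [map_sum, map_smul, hG2, sum_apply, smul_apply, sub_apply, inner_sum,
            inner_smul_right, inner_sub_right, rankOne_apply, e.inner_eq_ite]
          simp
      _ = g k l * ⟪e k, A (e l)⟫ - g l k * ⟪e l, A (e k)⟫ := by
          simp only [mul_sub, Finset.sum_sub_distrib, mul_ite, mul_one, mul_zero,
            Finset.sum_ite_eq, Finset.sum_ite_eq', Finset.mem_univ, if_true, Finset.sum_ite_irrel,
            Finset.sum_const_zero]
          ring
      _ = _ := by
          rw [hA l k, hgskew k l]
          ring
  linarith

theorem adjoint_eq_self_of_solution [CompleteSpace 𝓗]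
    (G : (𝓗 →L[ℝ] 𝓗) →L[ℝ] (𝓗 →L[ℝ] 𝓗))
    (hG : ∀ A, star A = A → star (G A) = -G A) {H : ℝ → 𝓗 →L[ℝ] 𝓗} (hH0 : star (H 0) = H 0)
    (hH : ∀ t ∈ Ici (0 : ℝ),
      HasDerivWithinAt H (H t * G (H t) - G (H t) * H t) (Ici 0) t) :
    ∀ t ∈ Ici (0 : ℝ), star (H t) = H t := by
  intro T hT
  have hcont : ContinuousOn H (Icc 0 T) := fun t ht =>
    (hH t ht.1).continuousWithinAt.mono Icc_subset_Ici_self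
  have hnorm : ∀ A : 𝓗 →L[ℝ] 𝓗, ‖star A‖ = ‖A‖ := adjoint.norm_map
  obtain ⟨M, hM⟩ := isCompact_Icc.exists_bound_of_continuousOn hcont
  have hK : ∀ t ∈ Ici (0 : ℝ), HasDerivWithinAt (fun t => H t - star (H t))
      ((H t * G (H t) - G (H t) * H t) - star (H t * G (H t) - G (H t) * H t)) (Ici 0) t :=
    fun t ht => (hH t ht).sub (hH t ht).star
  have hbound : ∀ t ∈ Ico 0 T,
      ‖(H t * G (H t) - G (H t) * H t) - star (H t * G (H t) - G (H t) * H t)‖ ≤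
        4 * ‖G‖ * M * ‖H t - star (H t)‖ := by
    intro t ht
    have hMt := hM t (Ico_subset_Icc_self ht)
    have hM0 : 0 ≤ M := (norm_nonneg _).trans hMt
    generalize H t = X at *
    set S : 𝓗 →L[ℝ] 𝓗 := (2⁻¹ : ℝ) • (X + star X) with hS
    set D : 𝓗 →L[ℝ] 𝓗 := (2⁻¹ : ℝ) • (X - star X) with hD
    have hSM : ‖S‖ ≤ M := by
      rw [hS, norm_smul]
      have := norm_add_le X (star X)
      rw [hnorm] at this
      norm_num
      linarith
    have hDn : ‖D‖ = 2⁻¹ * ‖X - star X‖ := by rw [hD, norm_smul]; norm_num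
    have hX : X = S + D := by rw [hS, hD]; module
    have hSs : star S = S := by simp [hS, add_comm]
    have hFS : star (S * G S - G S * S) = S * G S - G S * S := by
      simp only [star_sub, star_mul, hG S hSs, hSs]
      noncomm_ring
    set F : 𝓗 →L[ℝ] 𝓗 := X * G D + D * G S - G D * X - G S * D with hF
    have hXF : X * G X - G X * X = (S * G S - G S * S) + F := by
      have : G X = G S + G D := by rw [hX, map_add]
      rw [hF, this, hX]
      noncomm_ring
    have hFn : ‖F‖ ≤ 4 * (M * (‖G‖ * ‖D‖)) := by
      have hGD : ‖G D‖ ≤ ‖G‖ * ‖D‖ := G.le_opNorm D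
      have hGS : ‖G S‖ ≤ ‖G‖ * M := G.le_opNorm_of_le hSM
      have h1 : ‖X * G D‖ ≤ M * (‖G‖ * ‖D‖) := norm_mul_le_of_le hMt hGD
      have h2 : ‖D * G S‖ ≤ ‖D‖ * (‖G‖ * M) := norm_mul_le_of_le le_rfl hGS
      have h3 : ‖G D * X‖ ≤ (‖G‖ * ‖D‖) * M := norm_mul_le_of_le hGD hMt
      have h4 : ‖G S * D‖ ≤ (‖G‖ * M) * ‖D‖ := norm_mul_le_of_le hGS le_rfl
      refine (norm_sub_le_of_le (norm_sub_le_of_le (norm_add_le_of_le h1 h2) h3) h4).trans_eq ?_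
      ring
    calc _ = ‖F - star F‖ := by rw [hXF, star_add, hFS, add_sub_add_left_eq_sub]
      _ ≤ ‖F‖ + ‖F‖ := (norm_sub_le _ _).trans_eq (by rw [hnorm])
      _ ≤ 2 * (4 * (M * (‖G‖ * ‖D‖))) := by linarith
      _ = _ := by rw [hDn]; ring
  have := eq_zero_of_abs_deriv_le_mul_abs_self_of_eq_zero_right
    (fun t ht => (hK t ht.1).continuousWithinAt.mono Icc_subset_Ici_self)
    (fun t ht => (hK t ht.1).mono (Ici_subset_Ici.2 ht.1)) (by simp [hH0]) hbound T ⟨hT, le_rfl⟩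
  exact (sub_eq_zero.1 this).symm

theorem trace_pow_eq_of_solution [FiniteDimensional ℝ 𝓗] {B H : ℝ → 𝓗 →L[ℝ] 𝓗}
    (hH : ∀ t ∈ Ici (0 : ℝ), HasDerivWithinAt H (H t * B t - B t * H t) (Ici 0) t) (n : ℕ) :
    ∀ t ∈ Ici (0 : ℝ),
      LinearMap.trace ℝ 𝓗 ((H t ^ n : 𝓗 →L[ℝ] 𝓗) : 𝓗 →ₗ[ℝ] 𝓗) =
        LinearMap.trace ℝ 𝓗 ((H 0 ^ n : 𝓗 →L[ℝ] 𝓗) : 𝓗 →ₗ[ℝ] 𝓗) := by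
  intro T hT
  set τ : (𝓗 →L[ℝ] 𝓗) →L[ℝ] ℝ :=
    LinearMap.toContinuousLinearMap (LinearMap.trace ℝ 𝓗 ∘ₗ coeLM ℝ) with hτ
  have hτB : ∀ A C : 𝓗 →L[ℝ] 𝓗, τ (A * C - C * A) = 0 := fun A C => by
    rw [map_sub, sub_eq_zero]
    exact LinearMap.trace_mul_comm ℝ (A : 𝓗 →ₗ[ℝ] 𝓗) C
  have hder : ∀ t ∈ Ici (0 : ℝ), HasDerivWithinAt (fun t => τ (H t ^ n)) 0 (Ici 0) t :=
    fun t ht => (τ.hasFDerivAt.comp_hasDerivWithinAt t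
      (hasDerivWithinAt_pow_of_commutator (hH t ht) n)).congr_deriv (hτB _ _)
  exact constant_of_has_deriv_right_zero
    (fun t ht => (hder t ht.1).continuousWithinAt.mono Icc_subset_Ici_self)
    (fun t ht => (hder t ht.1).mono (Ici_subset_Ici.2 ht.1)) T ⟨hT, le_rfl⟩

end LaxPair

/-- finite dimension: convergence to a diagonal operator carrying all the
eigenvalues. Let `𝓗` be a real Hilbert space of finite dimension `d`, and
`G : S(𝓗) → A(𝓗)` a linear diagonalizable map with constant matrix-eigenvalue `(g i j)`
satisfying the sign condition and `g ℓ j ≠ 0` for `j ≠ ℓ`. Then for every symmetric `H₀`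
the solution of `H' = [H, G(H)]`, `H(0) = H₀` converges in operator norm to a diagonal
operator `H∞ = diag(α_ℓ)`, and `α₀, …, α_{d-1}` are exactly the eigenvalues of `H₀` counted
with multiplicity. -/
theorem stmt9
    {𝓗 : Type*} [NormedAddCommGroup 𝓗] [InnerProductSpace ℝ 𝓗] [FiniteDimensional ℝ 𝓗]
    {d : ℕ} (e : OrthonormalBasis (Fin d) ℝ 𝓗)
    (G : (𝓗 →L[ℝ] 𝓗) → (𝓗 →L[ℝ] 𝓗))
    (hGadd : ∀ A B, G (A + B) = G A + G B)
    (hGsmul : ∀ (c : ℝ) A, G (c • A) = c • G A)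
    (hGskew : ∀ A : 𝓗 →L[ℝ] 𝓗, (∀ x y, ⟪A x, y⟫ = ⟪x, A y⟫) →
      ∀ x y, ⟪G A x, y⟫ = -⟪x, G A y⟫)
    (g : Fin d → Fin d → ℝ)
    (hgskew : ∀ i j, g j i = -g i j)
    (hGdiag : ∀ i j, G (EsymF e i j) = g i j • EskewF e i j)
    (ε : Fin d → ℝ) (hε : ∀ ℓ, ε ℓ = 1 ∨ ε ℓ = -1)
    (hsign : ∀ k ℓ : Fin d, ℓ ≤ k → 0 ≤ ε ℓ * g ℓ k)
    (hnonzero : ∀ ℓ j : Fin d, j ≠ ℓ → g ℓ j ≠ 0)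
    (H₀ : 𝓗 →L[ℝ] 𝓗)
    (hH₀sym : ∀ x y, ⟪H₀ x, y⟫ = ⟪x, H₀ y⟫)
    -- `H` is the solution of the Cauchy problem on `[0,∞)`
    (H : ℝ → 𝓗 →L[ℝ] 𝓗)
    (hH0 : H 0 = H₀)
    (hODE : ∀ t ∈ Ici (0 : ℝ),
      HasDerivWithinAt H (H t * G (H t) - G (H t) * H t) (Ici 0) t) :
    ∃ Hinf : 𝓗 →L[ℝ] 𝓗, ∃ α : Fin d → ℝ,
      -- convergence in operator norm to the diagonal operator `H∞ = diag(α_ℓ)`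
      Tendsto H atTop (nhds Hinf) ∧
      (∀ ℓ, Hinf (e ℓ) = α ℓ • e ℓ) ∧
      -- the `α_ℓ` are exactly the eigenvalues of `H₀` counted with multiplicity
      ∃ f : OrthonormalBasis (Fin d) ℝ 𝓗, ∀ ℓ, H₀ (f ℓ) = α ℓ • f ℓ := by
  obtain ⟨Γ, hΓ⟩ : ∃ Γ : (𝓗 →L[ℝ] 𝓗) →L[ℝ] (𝓗 →L[ℝ] 𝓗), ∀ A, Γ A = G A :=
    ⟨LinearMap.toContinuousLinearMap
      { toFun := G, map_add' := hGadd, map_smul' := hGsmul }, fun _ => rfl⟩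
  simp only [← hΓ] at hGskew hGdiag hODE
  have hsymm : ∀ A : 𝓗 →L[ℝ] 𝓗, star A = A ↔ ∀ x y, ⟪A x, y⟫ = ⟪x, A y⟫ := fun A =>
    isSelfAdjoint_iff_isSymmetric (A := A)
  have hstar : ∀ t ∈ Ici (0 : ℝ), star (H t) = H t := by
    refine adjoint_eq_self_of_solution Γ (fun A hA => ?_) ?_ hODE
    · rw [star_eq_adjoint, eq_comm, eq_adjoint_iff]
      intro x y
      rw [neg_apply, inner_neg_left, hGskew A ((hsymm A).1 hA), neg_neg]
    · rw [hH0]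
      exact (hsymm H₀).2 hH₀sym
  have hsym : ∀ t ∈ Ici (0 : ℝ), ∀ x y, ⟪x, H t y⟫ = ⟪y, H t x⟫ := fun t ht x y => by
    rw [← (hsymm _).1 (hstar t ht) x y, real_inner_comm]
  have htrace := trace_pow_eq_of_solution hODE
  have hbound : ∀ t ∈ Ici (0 : ℝ), ∀ i j, |⟪e i, H t (e j)⟫| ≤
      √(LinearMap.trace ℝ 𝓗 ((H 0 ^ 2 : 𝓗 →L[ℝ] 𝓗) : 𝓗 →ₗ[ℝ] 𝓗)) := by
    intro t ht i j
    have h1 : |⟪e i, H t (e j)⟫| ≤ ‖H t (e j)‖ := by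
      simpa using abs_real_inner_le_norm (e i) (H t (e j))
    refine h1.trans (Real.le_sqrt_of_sq_le ?_)
    rw [← htrace 2 t ht, LinearMap.trace_eq_sum_inner _ e]
    have h2 : ∀ k, ⟪e k, ((H t ^ 2 : 𝓗 →L[ℝ] 𝓗) : 𝓗 →ₗ[ℝ] 𝓗) (e k)⟫ = ‖H t (e k)‖ ^ 2 := by
      intro k
      rw [ContinuousLinearMap.coe_coe, pow_two, mul_apply_eq_comp, hsym t ht,
        real_inner_self_eq_norm_sq]
    simp only [h2]
    exact Finset.single_le_sum (f := fun k => ‖H t (e k)‖ ^ 2) (fun k _ => by positivity)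
      (Finset.mem_univ j)
  have hentry : ∀ t ∈ Ici (0 : ℝ), ∀ i j, HasDerivWithinAt (fun t => ⟪e i, H t (e j)⟫)
      (∑ k, (⟪e i, H t (e k)⟫ * (g k j * ⟪e k, H t (e j)⟫) -
        g i k * ⟪e i, H t (e k)⟫ * ⟪e k, H t (e j)⟫)) (Ici 0) t := by
    intro t ht i j
    have hGe := inner_map_apply_eq e Γ.toLinearMap hgskew hGdiag
      (fun i j => hsym t ht (e i) (e j))
    simp only [ContinuousLinearMap.coe_coe] at hGe
    have hmul : ∀ A B : 𝓗 →L[ℝ] 𝓗,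
        ⟪e i, (A * B) (e j)⟫ = ∑ k, ⟪e i, A (e k)⟫ * ⟪e k, B (e j)⟫ := by
      intro A B
      rw [mul_apply_eq_comp]
      conv_lhs => rw [← e.sum_repr' (B (e j)), map_sum, inner_sum]
      exact Finset.sum_congr rfl fun k _ => by rw [map_smul, inner_smul_right, mul_comm]
    refine (((innerSL ℝ (e i)).comp (ContinuousLinearMap.apply ℝ 𝓗 (e j))).hasFDerivAt
      |>.comp_hasDerivWithinAt t (hODE t ht)).congr_deriv ?_
    change ⟪e i, (H t * Γ (H t) - Γ (H t) * H t) (e j)⟫ = _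
    rw [sub_apply, inner_sub_right, hmul, hmul, ← Finset.sum_sub_distrib]
    simp only [hGe]
  obtain ⟨hdiag, hoff⟩ := tendsto_entries hgskew hε hsign hnonzero
    (fun t ht i j => hsym t ht (e i) (e j)) hbound hentry
  choose α hα using hdiag
  obtain ⟨Hinf, hHinf⟩ : ∃ Hinf : 𝓗 →L[ℝ] 𝓗,
      Hinf = ∑ i, ∑ j, (if i = j then α i else 0) • rankOne (e j) (e i) := ⟨_, rfl⟩
  have htend : Tendsto H atTop (nhds Hinf) := by
    rw [hHinf, ← funext fun t => sum_inner_smul_rankOne e (H t)]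
    refine tendsto_finsetSum _ fun i _ => tendsto_finsetSum _ fun j _ => Tendsto.smul_const ?_ _
    split_ifs with h
    · subst h
      exact hα i
    · exact hoff i j h
  have hHinfe : ∀ ℓ, Hinf (e ℓ) = α ℓ • e ℓ := by
    intro ℓ
    simp [hHinf, rankOne_apply, e.inner_eq_ite, sum_apply, ite_smul]
  refine ⟨Hinf, α, htend, hHinfe, ?_⟩
  have hd : Module.finrank ℝ 𝓗 = d := by simpa using Module.finrank_eq_card_basis e.toBasis
  have hT : (H₀ : 𝓗 →ₗ[ℝ] 𝓗).IsSymmetric := hH₀sym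
  have hev : ∀ i, H₀ (hT.eigenvectorBasis hd i) =
      hT.eigenvalues hd i • hT.eigenvectorBasis hd i := hT.apply_eigenvectorBasis hd
  have hpow : ∀ n : ℕ, ∑ i, α i ^ n = ∑ i, hT.eigenvalues hd i ^ n := by
    intro n
    rw [← trace_pow_eq_sum e hHinfe, ← trace_pow_eq_sum (hT.eigenvectorBasis hd) hev]
    have hcont : Continuous fun A : 𝓗 →L[ℝ] 𝓗 =>
        LinearMap.trace ℝ 𝓗 ((A ^ n : 𝓗 →L[ℝ] 𝓗) : 𝓗 →ₗ[ℝ] 𝓗) :=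
      (LinearMap.continuous_of_finiteDimensional (LinearMap.trace ℝ 𝓗 ∘ₗ coeLM ℝ)).comp
        (continuous_pow n)
    refine tendsto_nhds_unique ((hcont.tendsto Hinf).comp htend)
      (tendsto_const_nhds.congr' ?_)
    filter_upwards [eventually_ge_atTop 0] with t ht
    rw [Function.comp_apply, htrace n t ht, hH0]
  obtain ⟨σ, hσ⟩ := exists_perm_of_sum_pow_eq hpow
  refine ⟨(hT.eigenvectorBasis hd).reindex σ.symm, fun ℓ => ?_⟩
  rw [OrthonormalBasis.reindex_apply, Equiv.symm_symm, ← hσ]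
  exact hev (σ ℓ)
end

section
/- Let H be a real Hilbert space of finite dimension d, G : S(H) → A(H) a linear diagonalizable map with constant matrix-eigenvalue (g_{i,j}) satisfying the sign and nonvanishing conditions, and let H₀ be symmetric with simple eigenvalues. Let H(t) = U(t)* H₀ U(t) be the solution of H' = [H, G(H)], where U solves U' = U G(H), U(0) = Id. Then U(t) converges as t → +∞ to a limit U_∞, and if Q₀ is orthogonal with Q₀H₀Q₀* diagonal with non-increasing entries, then Π Q₀ U_∞ is a diagonal matrix with entries ±1 for some permutation matrix Π. -/
open MeasureTheory Filter Set ContinuousLinearMap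
open scoped RealInnerProductSpace

open Topology in
/-- A function on `[0, ∞)` with values in `[-1, 1]` such that `u² (1 - u²) → 0` converges. -/
lemma exists_tendsto_of_sq_mul_one_sub_sq {u : ℝ → ℝ} (hu : ContinuousOn u (Ici 0))
    (hb : ∀ t ∈ Ici (0 : ℝ), |u t| ≤ 1)
    (h : Tendsto (fun t => u t ^ 2 * (1 - u t ^ 2)) atTop (𝓝 0)) :
    ∃ L, Tendsto u atTop (𝓝 L) := by
  have hev : ∀ᶠ t in atTop, |u t| ≤ 1 := by
    filter_upwards [eventually_ge_atTop 0] with t ht using hb t ht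
  refine tendsto_of_no_upcrossings dense_univ ?_ ?_ ?_
  · rintro a - b - hab ⟨ha, hb'⟩
    obtain ⟨c, hca, hcb, hc⟩ : ∃ c, a < c ∧ c < b ∧ c ^ 2 * (1 - c ^ 2) ≠ 0 := by
      have hfin : ({0, 1, -1} : Set ℝ).Finite := by simp
      obtain ⟨c, hc, hc'⟩ := (Ioo_infinite hab).exists_notMem_finite hfin
      refine ⟨c, hc.1, hc.2, fun h0 => hc' ?_⟩
      rcases mul_eq_zero.1 h0 with h1 | h1
      · left; exact pow_eq_zero_iff two_ne_zero |>.1 h1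
      · have : (c - 1) * (c + 1) = 0 := by linarith
        rcases mul_eq_zero.1 this with h2 | h2
        · right; left; linarith
        · right; right; simp only [mem_singleton_iff]; linarith
    have hne : ∀ᶠ t in atTop, u t ≠ c := by
      filter_upwards [h.eventually_ne hc.symm] with t ht hcon
      exact ht (by rw [hcon])
    obtain ⟨T, hT⟩ := eventually_atTop.1 (hne.and (eventually_ge_atTop 0))
    obtain ⟨t₁, ht₁, h₁⟩ := frequently_atTop.1 ha T
    obtain ⟨t₂, ht₂, h₂⟩ := frequently_atTop.1 hb' t₁
    obtain ⟨s, hs, hsc⟩ := intermediate_value_Icc ht₂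
      (hu.mono fun x hx => (hT _ ht₁).2.trans hx.1) ⟨h₁.le.trans hca.le, hcb.le.trans h₂.le⟩
    exact (hT s (ht₁.trans hs.1)).1 hsc
  · exact ⟨1, by simpa using hev.mono fun t ht => (abs_le.1 ht).2⟩
  · exact ⟨-1, by simpa using hev.mono fun t ht => (abs_le.1 ht).1⟩

open Topology in
/-- **Barbalat's lemma**: a uniformly continuous dissipation rate of a Lyapunov function
bounded below tends to zero. -/
lemma tendsto_zero_of_dissipation {f φ : ℝ → ℝ}
    (hφ : ∀ t ∈ Ici (0 : ℝ), HasDerivWithinAt φ (-f t) (Ici 0) t)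
    (hf0 : ∀ t ∈ Ici (0 : ℝ), 0 ≤ f t) (hf : UniformContinuousOn f (Ici 0))
    {m : ℝ} (hm : ∀ t ∈ Ici (0 : ℝ), m ≤ φ t) :
    Tendsto f atTop (𝓝 0) := by
  have hderiv : ∀ t, 0 < t → HasDerivAt φ (-f t) t := fun t ht =>
    (hφ t ht.le).hasDerivAt (Ici_mem_nhds ht)
  have hcont : ContinuousOn φ (Ici 0) := fun t ht => (hφ t ht).continuousWithinAt
  have hanti : AntitoneOn φ (Ici 0) := by
    refine antitoneOn_of_deriv_nonpos (convex_Ici 0) hcont ?_ ?_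
    · intro t ht
      rw [interior_Ici] at ht
      exact (hderiv t ht).differentiableAt.differentiableWithinAt
    · intro t ht
      rw [interior_Ici] at ht
      rw [(hderiv t ht).deriv]
      linarith [hf0 t (mem_Ici.2 (mem_Ioi.1 ht).le)]
  obtain ⟨L, hL⟩ : ∃ L, Tendsto φ atTop (𝓝 L) := by
    have hanti' : Antitone fun t => φ (max t 0) := fun s t hst =>
      hanti (mem_Ici.2 (le_max_right _ _)) (mem_Ici.2 (le_max_right _ _)) (max_le_max_right 0 hst)
    have hbdd : BddBelow (range fun t => φ (max t 0)) :=
      ⟨m, by rintro _ ⟨t, rfl⟩; exact hm _ (mem_Ici.2 (le_max_right _ _))⟩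
    refine ⟨_, (tendsto_atTop_ciInf hanti' hbdd).congr' ?_⟩
    filter_upwards [eventually_ge_atTop 0] with t ht
    rw [max_eq_left ht]
  rw [Metric.tendsto_nhds]
  intro η hη
  obtain ⟨δ, hδ, hfδ⟩ := Metric.uniformContinuousOn_iff.1 hf (η / 2) (half_pos hη)
  have hδ2 : 0 < δ / 2 := half_pos hδ
  have hdiff : Tendsto (fun t => φ t - φ (t + δ / 2)) atTop (𝓝 0) := by
    simpa using hL.sub (hL.comp (tendsto_atTop_add_const_right _ (δ / 2) tendsto_id))
  filter_upwards [hdiff.eventually_lt_const (show 0 < η / 2 * (δ / 2) by positivity),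
    eventually_ge_atTop 0] with t ht ht0
  obtain ⟨c, hc, hc'⟩ := exists_hasDerivAt_eq_slope φ (fun s => -f s)
    (show t < t + δ / 2 by linarith) (hcont.mono fun x hx => ht0.trans hx.1)
    (fun x hx => hderiv x (ht0.trans_lt hx.1))
  have hfc : f c < η / 2 := by
    rw [eq_div_iff (by linarith)] at hc'
    nlinarith
  have hdist := hfδ t ht0 c (ht0.trans hc.1.le) (by
    rw [Real.dist_eq, abs_lt]; constructor <;> linarith [hc.1, hc.2])
  rw [Real.dist_eq, abs_lt] at hdist
  rw [Real.dist_eq, sub_zero, abs_of_nonneg (hf0 t ht0)]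
  linarith

open Topology in
/-- The dissipation rate of a Lyapunov function tends to zero along a trajectory of an autonomous
differential equation that stays in a compact set. -/
lemma tendsto_zero_of_dissipation_of_isCompact {E : Type*} [NormedAddCommGroup E] [NormedSpace ℝ E]
    {K : Set E} (hK : IsCompact K) {V : E → E} (hV : Continuous V) {X : ℝ → E}
    (hXK : ∀ t ∈ Ici (0 : ℝ), X t ∈ K)
    (hX : ∀ t ∈ Ici (0 : ℝ), HasDerivWithinAt X (V (X t)) (Ici 0) t)
    {F : E → ℝ} (hF : Continuous F) (hF0 : ∀ t ∈ Ici (0 : ℝ), 0 ≤ F (X t)) {φ : ℝ → ℝ}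
    (hφ : ∀ t ∈ Ici (0 : ℝ), HasDerivWithinAt φ (-F (X t)) (Ici 0) t)
    {m : ℝ} (hm : ∀ t ∈ Ici (0 : ℝ), m ≤ φ t) :
    Tendsto (fun t => F (X t)) atTop (𝓝 0) := by
  obtain ⟨C, hC⟩ := hK.exists_bound_of_continuousOn hV.continuousOn
  have hLip : LipschitzOnWith C.toNNReal X (Ici 0) :=
    (convex_Ici 0).lipschitzOnWith_of_nnnorm_hasDerivWithin_le hX fun t ht => by
      rw [← NNReal.coe_le_coe, coe_nnnorm]
      exact (hC _ (hXK t ht)).trans (Real.le_coe_toNNReal C)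
  exact tendsto_zero_of_dissipation hφ hF0
    ((hK.uniformContinuousOn_of_continuous hF.continuousOn).comp hLip.uniformContinuousOn hXK) hm

/-- An orthonormal family whose members each have at most one nonzero coordinate in an orthonormal
basis is, up to signs, a permutation of that basis. -/
lemma OrthonormalBasis.exists_perm_sign_of_orthonormal {ι E : Type*} [Fintype ι]
    [NormedAddCommGroup E] [InnerProductSpace ℝ E] (f : OrthonormalBasis ι ℝ E) {v : ι → E}
    (hv : Orthonormal ℝ v) (h : ∀ i k l, k ≠ l → ⟪f k, v i⟫ * ⟪f l, v i⟫ = 0) :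
    ∃ (τ : Equiv.Perm ι) (s : ι → ℝ), (∀ i, s i = 1 ∨ s i = -1) ∧ ∀ i, v i = s i • f (τ i) := by
  have hex : ∀ i, ∃ k, ⟪f k, v i⟫ ≠ 0 := by
    intro i
    by_contra! hcon
    refine hv.ne_zero i ?_
    rw [← f.sum_repr' (v i)]
    simp [hcon]
  choose τ hτ using hex
  have hvτ : ∀ i, v i = ⟪f (τ i), v i⟫ • f (τ i) := by
    intro i
    conv_lhs => rw [← f.sum_repr' (v i)]
    refine Finset.sum_eq_single _ (fun k _ hk => ?_) (by simp)
    rw [(mul_eq_zero.1 (h i k (τ i) hk)).resolve_right (hτ i), zero_smul]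
  have hinj : Function.Injective τ := by
    intro i j hij
    by_contra hne
    have h0 := hv.inner_eq_zero hne
    rw [hvτ i, hvτ j, hij, real_inner_smul_left, real_inner_smul_right,
      real_inner_self_eq_norm_sq, f.norm_eq_one] at h0
    rcases mul_eq_zero.1 h0 with h1 | h1
    · exact hτ i (hij ▸ h1)
    · exact hτ j (by simpa using h1)
  refine ⟨Equiv.ofBijective τ (Finite.injective_iff_bijective.1 hinj), fun i => ⟪f (τ i), v i⟫,
    fun i => ?_, hvτ⟩
  have h1 := hv.norm_eq_one i
  rw [hvτ i, norm_smul, f.norm_eq_one, mul_one, Real.norm_eq_abs] at h1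
  exact eq_or_eq_neg_of_abs_eq h1

lemma rankOne_basis_apply {ι 𝓗 : Type*} [Fintype ι] [DecidableEq ι] [NormedAddCommGroup 𝓗]
    [InnerProductSpace ℝ 𝓗] (e : OrthonormalBasis ι ℝ 𝓗) (i k : ι) (v : 𝓗) :
    rankOne (e i) v (e k) = if i = k then v else 0 := by
  simp [rankOne, e.inner_eq_ite]

/-- The matrix entries of `G X` for a diagonalizable map `G` and a symmetric operator `X`. -/
lemma inner_diagonalizable_apply {𝓗 : Type*} [NormedAddCommGroup 𝓗] [InnerProductSpace ℝ 𝓗]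
    {d : ℕ} (e : OrthonormalBasis (Fin d) ℝ 𝓗) (G : (𝓗 →L[ℝ] 𝓗) →ₗ[ℝ] (𝓗 →L[ℝ] 𝓗))
    {g : Fin d → Fin d → ℝ} (hgskew : ∀ i j, g j i = -g i j)
    (hGdiag : ∀ i j, G (EsymF e i j) = g i j • EskewF e i j)
    {X : 𝓗 →L[ℝ] 𝓗} (hX : ∀ x y, ⟪X x, y⟫ = ⟪x, X y⟫) (a b : Fin d) :
    ⟪e a, G X (e b)⟫ = g a b * ⟪e a, X (e b)⟫ := by
  have hxs : ∀ i j, ⟪e i, X (e j)⟫ = ⟪e j, X (e i)⟫ := fun i j => by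
    rw [← hX, real_inner_comm]
  have hP : ∀ i j, G (rankOne (e j) (e i) + rankOne (e i) (e j)) =
      g i j • (rankOne (e j) (e i) - rankOne (e i) (e j)) := by
    intro i j
    have h2 : Real.sqrt 2 ≠ 0 := by positivity
    by_cases hij : i = j
    · subst hij
      have := hGdiag i i
      simp only [EsymF, EskewF, if_true, sub_self, smul_zero] at this
      simp [this]
    · have := hGdiag i j
      simp only [EsymF, EskewF, if_neg hij, map_smul] at this
      rw [smul_comm] at this
      exact smul_right_injective _ (inv_ne_zero h2) this
  have hXsum : X = ∑ i, ∑ j, (⟪e i, X (e j)⟫ / 2) •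
      (rankOne (e j) (e i) + rankOne (e i) (e j)) := by
    have hswap : ∑ i, ∑ j, (⟪e i, X (e j)⟫ / 2) • rankOne (e i) (e j) =
        ∑ i, ∑ j, (⟪e i, X (e j)⟫ / 2) • rankOne (e j) (e i) := by
      rw [Finset.sum_comm]
      simp only [hxs]
    simp only [smul_add, Finset.sum_add_distrib, hswap]
    refine ContinuousLinearMap.coe_injective (e.toBasis.ext fun k => ?_)
    simp only [ContinuousLinearMap.coe_coe, e.coe_toBasis, add_apply,
      sum_apply, smul_apply, rankOne_basis_apply,
      smul_ite, smul_zero, Finset.sum_ite_eq', Finset.mem_univ, if_true]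
    conv_lhs => rw [← e.sum_repr' (X (e k))]
    rw [← Finset.sum_add_distrib]
    refine Finset.sum_congr rfl fun i _ => ?_
    rw [← add_smul, add_halves]
  conv_lhs => rw [hXsum]
  simp only [map_sum, map_smul, hP, sum_apply, smul_apply,
    sub_apply, rankOne_basis_apply, inner_sum, inner_sub_right,
    smul_sub, smul_ite, smul_zero,
    real_inner_smul_right, e.inner_eq_ite, mul_ite, mul_one, mul_zero, Finset.sum_sub_distrib,
    Finset.sum_ite_irrel, Finset.sum_const_zero, Finset.sum_ite_eq, Finset.sum_ite_eq',
    Finset.mem_univ, if_true]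
  rw [hxs b a, hgskew a b]
  ring

open Topology in
/-- In an orthonormal eigenbasis `f` of `H₀`, if the off-diagonal entries of `U* H₀ U` tend to
zero, then the orthogonal operators `U t` converge, and each limiting column has at most one
nonzero coordinate. -/
lemma exists_tendsto_of_offDiag_tendsto_zero {ι 𝓗 : Type*} [Fintype ι] [NormedAddCommGroup 𝓗]
    [InnerProductSpace ℝ 𝓗] [CompleteSpace 𝓗]
    (e f : OrthonormalBasis ι ℝ 𝓗) {β : ι → ℝ} (hβ : Function.Injective β)
    {H₀ : 𝓗 →L[ℝ] 𝓗} (hH₀sym : ∀ x y, ⟪H₀ x, y⟫ = ⟪x, H₀ y⟫) (hf : ∀ k, H₀ (f k) = β k • f k)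
    {U : ℝ → 𝓗 →L[ℝ] 𝓗} (hUc : ContinuousOn U (Ici 0))
    (hU : ∀ t ∈ Ici (0 : ℝ), adjoint (U t) * U t = 1)
    (hU' : ∀ t ∈ Ici (0 : ℝ), U t * adjoint (U t) = 1)
    (hoff : ∀ i j, i ≠ j →
      Tendsto (fun t => ⟪e j, (adjoint (U t) * H₀ * U t) (e i)⟫) atTop (𝓝 0)) :
    ∃ Uinf : 𝓗 →L[ℝ] 𝓗, Tendsto U atTop (𝓝 Uinf) ∧
      ∀ i k l, k ≠ l → ⟪f k, Uinf (e i)⟫ * ⟪f l, Uinf (e i)⟫ = 0 := by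
  set a : ι → ι → ℝ → ℝ := fun k i t => ⟪f k, U t (e i)⟫
  set h : ι → ι → ℝ → ℝ := fun j i t => ⟪e j, (adjoint (U t) * H₀ * U t) (e i)⟫
  have hnorm : ∀ t ∈ Ici (0 : ℝ), ∀ x, ‖U t x‖ = ‖x‖ := by
    intro t ht x
    rw [← sq_eq_sq₀ (norm_nonneg _) (norm_nonneg _), ← real_inner_self_eq_norm_sq,
      ← real_inner_self_eq_norm_sq, ← adjoint_inner_left]
    change ⟪(adjoint (U t) * U t) x, x⟫ = _
    rw [hU t ht]; rfl
  have ha1 : ∀ k i, ∀ t ∈ Ici (0 : ℝ), |a k i t| ≤ 1 := by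
    intro k i t ht
    refine (abs_real_inner_le_norm _ _).trans ?_
    rw [hnorm t ht, f.norm_eq_one, e.norm_eq_one, one_mul]
  have hac : ∀ k i, ContinuousOn (a k i) (Ici 0) := fun k i =>
    continuousOn_const.inner (hUc.clm_apply continuousOn_const)
  have hsum : ∀ i, ∀ t ∈ Ici (0 : ℝ), ∑ k, a k i t ^ 2 = 1 := by
    intro i t ht
    rw [f.sum_sq_inner_right, hnorm t ht, e.norm_eq_one, one_pow]
  have heig : ∀ k i, ∀ t ∈ Ici (0 : ℝ), β k * a k i t = ∑ j, h j i t * a k j t := by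
    intro k i t ht
    have h1 : β k * a k i t = ⟪f k, H₀ (U t (e i))⟫ := by
      rw [← hH₀sym, hf, real_inner_smul_left]
    have h2 : H₀ (U t (e i)) = U t ((adjoint (U t) * H₀ * U t) (e i)) := by
      change _ = (U t * adjoint (U t)) (H₀ (U t (e i)))
      rw [hU' t ht]; rfl
    rw [h1, h2, ← e.sum_repr' ((adjoint (U t) * H₀ * U t) (e i)), map_sum, inner_sum]
    refine Finset.sum_congr rfl fun j _ => ?_
    rw [map_smul, real_inner_smul_right]
  have hprod : ∀ i k l, k ≠ l → Tendsto (fun t => a k i t * a l i t) atTop (𝓝 0) := by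
    intro i k l hkl
    have hne : β k - β l ≠ 0 := sub_ne_zero.2 (hβ.ne hkl)
    have hterm : ∀ j, Tendsto (fun t => h j i t * (a k j t * a l i t - a k i t * a l j t))
        atTop (𝓝 0) := by
      intro j
      by_cases hij : i = j
      · subst hij
        simp [mul_comm]
      · refine (hoff i j hij).zero_mul_isBoundedUnder_le ⟨2, ?_⟩
        rw [eventually_map]
        filter_upwards [eventually_ge_atTop 0] with t ht
        have hm : ∀ p q r s : ι, |a p q t * a r s t| ≤ 1 := fun p q r s => by
          rw [abs_mul]
          exact mul_le_one₀ (ha1 _ _ t ht) (abs_nonneg _) (ha1 _ _ t ht)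
        have := abs_sub (a k j t * a l i t) (a k i t * a l j t)
        simp only [Function.comp_apply, Real.norm_eq_abs]
        linarith [hm k j l i, hm k i l j]
    have hlim : Tendsto (fun t => (β k - β l)⁻¹ *
        ∑ j, h j i t * (a k j t * a l i t - a k i t * a l j t)) atTop (𝓝 0) := by
      simpa using (tendsto_finsetSum Finset.univ fun j _ => hterm j).const_mul (β k - β l)⁻¹
    refine hlim.congr' ?_
    filter_upwards [eventually_ge_atTop 0] with t ht
    have h3 : ∑ j, h j i t * (a k j t * a l i t - a k i t * a l j t) =
        (β k * a k i t) * a l i t - a k i t * (β l * a l i t) := by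
      rw [heig k i t ht, heig l i t ht, Finset.sum_mul, Finset.mul_sum, ← Finset.sum_sub_distrib]
      exact Finset.sum_congr rfl fun j _ => by ring
    rw [h3]
    field_simp
  have hconv : ∀ k i, ∃ L, Tendsto (a k i) atTop (𝓝 L) := by
    classical
    intro k i
    refine exists_tendsto_of_sq_mul_one_sub_sq (hac k i) (ha1 k i) ?_
    have hlim : Tendsto (fun t => ∑ l ∈ Finset.univ.erase k, (a k i t * a l i t) ^ 2) atTop
        (𝓝 0) := by
      simpa using tendsto_finsetSum (Finset.univ.erase k) fun l hl =>
        (hprod i k l (Finset.ne_of_mem_erase hl).symm).pow 2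
    refine hlim.congr' ?_
    filter_upwards [eventually_ge_atTop 0] with t ht
    rw [← hsum i t ht, ← Finset.add_sum_erase _ _ (Finset.mem_univ k), add_sub_cancel_left,
      Finset.mul_sum]
    exact Finset.sum_congr rfl fun l _ => by ring
  choose L hL using hconv
  have hrep : ∀ t, U t = ∑ i, ∑ k, a k i t • rankOne (e i) (f k) := by
    intro t
    refine ContinuousLinearMap.coe_injective (e.toBasis.ext fun j => ?_)
    classical
    simp only [ContinuousLinearMap.coe_coe, e.coe_toBasis, sum_apply,
      smul_apply, rankOne_basis_apply, smul_ite, smul_zero]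
    rw [Finset.sum_comm]
    simp only [Finset.sum_ite_eq', Finset.mem_univ, if_true]
    exact (f.sum_repr' _).symm
  have hUlim : Tendsto U atTop (𝓝 (∑ i, ∑ k, L k i • rankOne (e i) (f k))) := by
    rw [funext hrep]
    exact tendsto_finsetSum _ fun i _ => tendsto_finsetSum _ fun k _ => (hL k i).smul_const _
  refine ⟨_, hUlim, fun i k l hkl => ?_⟩
  have hlim : ∀ k, Tendsto (a k i) atTop
      (𝓝 ⟪f k, (∑ i, ∑ k, L k i • rankOne (e i) (f k)) (e i)⟫) := fun k =>
    tendsto_const_nhds.inner (((ContinuousLinearMap.apply ℝ 𝓗 (e i)).continuous.tendsto _).comp hUlim)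
  exact tendsto_nhds_unique ((hlim k).mul (hlim l)) (hprod i k l hkl)

/-- convergence of the unitary flow. In finite dimension `d`, under the
sign and nonvanishing conditions on the matrix-eigenvalue `(g i j)` of `G`, let `H₀` be
symmetric with simple eigenvalues and let `H(t) = U(t)* H₀ U(t)` where `U` solves
`U' = U G(H)`, `U(0) = Id`. Then `U(t)` converges as `t → +∞` and, for any orthogonal `Q₀`
such that `Q₀ H₀ Q₀*` is diagonal with non-increasing entries, there is a permutation
operator `Π` such that `Π Q₀ U_∞` is a diagonal operator with entries `±1`. -/
theorem stmt12
    {𝓗 : Type*} [NormedAddCommGroup 𝓗] [InnerProductSpace ℝ 𝓗] [FiniteDimensional ℝ 𝓗]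
    [CompleteSpace 𝓗]
    {d : ℕ} (e : OrthonormalBasis (Fin d) ℝ 𝓗)
    (G : (𝓗 →L[ℝ] 𝓗) → (𝓗 →L[ℝ] 𝓗))
    (hGadd : ∀ A B, G (A + B) = G A + G B)
    (hGsmul : ∀ (c : ℝ) A, G (c • A) = c • G A)
    (hGskew : ∀ A : 𝓗 →L[ℝ] 𝓗, (∀ x y, ⟪A x, y⟫ = ⟪x, A y⟫) →
      ∀ x y, ⟪G A x, y⟫ = -⟪x, G A y⟫)
    (g : Fin d → Fin d → ℝ)
    (hgskew : ∀ i j, g j i = -g i j)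
    (hGdiag : ∀ i j, G (EsymF e i j) = g i j • EskewF e i j)
    (ε : Fin d → ℝ) (hε : ∀ ℓ, ε ℓ = 1 ∨ ε ℓ = -1)
    (hsign : ∀ k ℓ : Fin d, ℓ ≤ k → 0 ≤ ε ℓ * g ℓ k)
    (hnonzero : ∀ ℓ j : Fin d, j ≠ ℓ → g ℓ j ≠ 0)
    (H₀ : 𝓗 →L[ℝ] 𝓗)
    (hH₀sym : ∀ x y, ⟪H₀ x, y⟫ = ⟪x, H₀ y⟫)
    -- the eigenvalues of `H₀` are simple
    (hsimple : ∃ (f : OrthonormalBasis (Fin d) ℝ 𝓗) (β : Fin d → ℝ),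
      Function.Injective β ∧ ∀ ℓ, H₀ (f ℓ) = β ℓ • f ℓ)
    -- `U` solves `U' = U G(H)`, `U(0) = Id`, and `H(t) = U(t)* H₀ U(t)`
    (U H : ℝ → 𝓗 →L[ℝ] 𝓗)
    (hU0 : U 0 = 1)
    (hHdef : ∀ t, H t = adjoint (U t) * H₀ * U t)
    (hUODE : ∀ t ∈ Ici (0 : ℝ), HasDerivWithinAt U (U t * G (H t)) (Ici 0) t) :
    ∃ Uinf : 𝓗 →L[ℝ] 𝓗,
      Tendsto U atTop (nhds Uinf) ∧
      ∀ Q₀ : 𝓗 →L[ℝ] 𝓗,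
        (adjoint Q₀ * Q₀ = 1 ∧ Q₀ * adjoint Q₀ = 1) →
        ∀ β : Fin d → ℝ, Antitone β →
          (∀ i, (Q₀ * H₀ * adjoint Q₀) (e i) = β i • e i) →
          ∃ (σ : Equiv.Perm (Fin d)) (Perm : 𝓗 →L[ℝ] 𝓗) (εs : Fin d → ℝ),
            (∀ i, Perm (e i) = e (σ i)) ∧
            (∀ i, εs i = 1 ∨ εs i = -1) ∧
            (∀ i, (Perm * Q₀ * Uinf) (e i) = εs i • e i) := by
  classical
  obtain ⟨f, β, hβ, hf⟩ := hsimple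
  set 𝓖 : (𝓗 →L[ℝ] 𝓗) →ₗ[ℝ] (𝓗 →L[ℝ] 𝓗) := ⟨⟨G, hGadd⟩, hGsmul⟩
  have hGc : Continuous G := 𝓖.continuous_of_finiteDimensional
  have hentry : ∀ X : 𝓗 →L[ℝ] 𝓗, (∀ x y, ⟪X x, y⟫ = ⟪x, X y⟫) →
      ∀ a b, ⟪e a, G X (e b)⟫ = g a b * ⟪e a, X (e b)⟫ := fun X hX a b =>
    inner_diagonalizable_apply e 𝓖 hgskew hGdiag hX a b
  have hHsym : ∀ t x y, ⟪H t x, y⟫ = ⟪x, H t y⟫ := by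
    intro t x y
    rw [hHdef]
    change ⟪adjoint (U t) (H₀ (U t x)), y⟫ = ⟪x, adjoint (U t) (H₀ (U t y))⟫
    rw [adjoint_inner_left, adjoint_inner_right, hH₀sym]
  have hGstar : ∀ t, star (G (H t)) = -G (H t) := by
    intro t
    refine ContinuousLinearMap.ext fun x => ext_inner_right ℝ fun y => ?_
    rw [star_eq_adjoint, adjoint_inner_left, neg_apply, inner_neg_left,
      hGskew _ (hHsym t), neg_neg]
  have hUstar : ∀ t ∈ Ici (0 : ℝ),
      HasDerivWithinAt (fun t => star (U t)) (-(G (H t) * star (U t))) (Ici 0) t := by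
    intro t ht
    have := (hUODE t ht).star
    rwa [star_mul, hGstar, neg_mul] at this
  have hUU' : ∀ t ∈ Ici (0 : ℝ), U t * adjoint (U t) = 1 := by
    have hd : ∀ t ∈ Ici (0 : ℝ), HasDerivWithinAt (fun t => U t * star (U t)) 0 (Ici 0) t := by
      intro t ht
      refine ((hUODE t ht).mul (hUstar t ht)).congr_deriv ?_
      noncomm_ring
    intro t ht
    have hconst := constant_of_has_deriv_right_zero (a := 0) (b := t)
      (fun s hs => ((hd s hs.1).mono Icc_subset_Ici_self).continuousWithinAt)
      (fun s hs => (hd s hs.1).mono (Ici_subset_Ici.2 hs.1)) t ⟨ht, le_rfl⟩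
    simpa [hU0, star_eq_adjoint] using hconst
  have hUU : ∀ t ∈ Ici (0 : ℝ), adjoint (U t) * U t = 1 := by
    intro t ht
    have h1 : (U t : 𝓗 →ₗ[ℝ] 𝓗) * (adjoint (U t) : 𝓗 →L[ℝ] 𝓗) = 1 := by
      have := congrArg ((↑) : (𝓗 →L[ℝ] 𝓗) → 𝓗 →ₗ[ℝ] 𝓗) (hUU' t ht)
      exact this
    exact ContinuousLinearMap.coe_injective (mul_eq_one_comm.1 h1)
  have hHODE : ∀ t ∈ Ici (0 : ℝ),
      HasDerivWithinAt H (H t * G (H t) - G (H t) * H t) (Ici 0) t := by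
    intro t ht
    have hd : HasDerivWithinAt H (-(G (H t) * star (U t)) * H₀ * U t +
        star (U t) * H₀ * (U t * G (H t))) (Ici 0) t := by
      refine HasDerivWithinAt.congr_of_eventuallyEq (f := fun t => star (U t) * H₀ * U t) ?_
        (Eventually.of_forall hHdef) (hHdef t)
      exact ((hUstar t ht).mul_const H₀).mul (hUODE t ht)
    refine hd.congr_deriv ?_
    have : H t = star (U t) * H₀ * U t := hHdef t
    generalize G (H t) = A
    rw [this]
    noncomm_ring
  have hHbound : ∀ t ∈ Ici (0 : ℝ), H t ∈ Metric.closedBall (0 : 𝓗 →L[ℝ] 𝓗) ‖H₀‖ := by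
    intro t ht
    have hiso : ∀ x, ‖U t x‖ = ‖x‖ := (norm_map_iff_adjoint_comp_self (U t)).2 (hUU t ht)
    have hU1 : ‖U t‖ ≤ 1 := opNorm_le_bound _ zero_le_one fun x => by rw [hiso, one_mul]
    have hU1' : ‖adjoint (U t)‖ ≤ 1 := by rwa [LinearIsometryEquiv.norm_map]
    rw [mem_closedBall_zero_iff, hHdef]
    calc ‖adjoint (U t) * H₀ * U t‖ ≤ ‖adjoint (U t)‖ * ‖H₀‖ * ‖U t‖ :=
          (norm_mul_le _ _).trans (mul_le_mul_of_nonneg_right (norm_mul_le _ _) (norm_nonneg _))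
      _ ≤ 1 * ‖H₀‖ * 1 := by gcongr
      _ = ‖H₀‖ := by ring
  -- weights making `∑ ℓ, w ℓ * ⟪e ℓ, H e ℓ⟫` a strict Lyapunov function
  set w : Fin d → ℝ := fun ℓ => ((d : ℝ) - ℓ) * ε ℓ with hw
  have hwpos : ∀ k ℓ : Fin d, ℓ ≠ k → 0 < (w ℓ - w k) * g ℓ k := by
    have key : ∀ k ℓ : Fin d, ℓ < k → 0 < (w ℓ - w k) * g ℓ k := by
      intro k ℓ hlt
      have h1 : 0 < ε ℓ * g ℓ k := by
        refine lt_of_le_of_ne (hsign k ℓ hlt.le) (mul_ne_zero ?_ (hnonzero ℓ k hlt.ne')).symm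
        rcases hε ℓ with h | h <;> rw [h] <;> norm_num
      have h2 : ε k * g ℓ k ≤ ε ℓ * g ℓ k := by
        rcases hε ℓ with h | h <;> rcases hε k with h' | h' <;> rw [h] at h1 ⊢ <;> rw [h'] <;>
          linarith
      have h3 : ((ℓ : ℕ) : ℝ) < (k : ℕ) := by exact_mod_cast hlt
      have h4 : ((k : ℕ) : ℝ) < d := by exact_mod_cast k.2
      simp only [hw]
      nlinarith
    intro k ℓ hne
    rcases lt_or_gt_of_ne hne with h | h
    · exact key k ℓ h
    · have := key ℓ k h
      rw [hgskew ℓ k] at this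
      linarith
  set F : (𝓗 →L[ℝ] 𝓗) → ℝ := fun X => -(2 * ∑ ℓ, w ℓ * ⟪X (e ℓ), G X (e ℓ)⟫) with hF
  have hFc : Continuous F := by
    simp only [hF]
    fun_prop
  have hFeq : ∀ t, F (H t) =
      ∑ ℓ, ∑ k, (w ℓ - w k) * g ℓ k * ⟪e ℓ, H t (e k)⟫ ^ 2 := by
    intro t
    have hs : ∀ i j, ⟪e i, H t (e j)⟫ = ⟪e j, H t (e i)⟫ := fun i j => by
      rw [← hHsym, real_inner_comm]
    have h1 : ∀ ℓ, ⟪H t (e ℓ), G (H t) (e ℓ)⟫ = -∑ k, g ℓ k * ⟪e ℓ, H t (e k)⟫ ^ 2 := by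
      intro ℓ
      rw [← e.sum_inner_mul_inner, ← Finset.sum_neg_distrib]
      refine Finset.sum_congr rfl fun k _ => ?_
      rw [hentry _ (hHsym t), hHsym, hs k ℓ, hgskew ℓ k]
      ring
    have h2 : ∑ ℓ, ∑ k, w k * g ℓ k * ⟪e ℓ, H t (e k)⟫ ^ 2 =
        -∑ ℓ, ∑ k, w ℓ * g ℓ k * ⟪e ℓ, H t (e k)⟫ ^ 2 := by
      rw [Finset.sum_comm, ← Finset.sum_neg_distrib]
      refine Finset.sum_congr rfl fun ℓ _ => ?_
      rw [← Finset.sum_neg_distrib]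
      refine Finset.sum_congr rfl fun k _ => ?_
      rw [hs k ℓ, hgskew ℓ k]
      ring
    have h3 : F (H t) = 2 * ∑ ℓ, ∑ k, w ℓ * g ℓ k * ⟪e ℓ, H t (e k)⟫ ^ 2 := by
      simp only [hF, h1, mul_neg, Finset.sum_neg_distrib, neg_neg, Finset.mul_sum, mul_assoc]
    simp only [sub_mul, Finset.sum_sub_distrib]
    rw [h3, h2]
    ring
  have hFterm : ∀ t, ∀ ℓ k, 0 ≤ (w ℓ - w k) * g ℓ k * ⟪e ℓ, H t (e k)⟫ ^ 2 := by
    intro t ℓ k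
    by_cases hne : ℓ = k
    · simp [hne]
    · exact mul_nonneg (hwpos k ℓ hne).le (sq_nonneg _)
  have hF0 : ∀ t ∈ Ici (0 : ℝ), 0 ≤ F (H t) := fun t _ => by
    rw [hFeq]
    exact Finset.sum_nonneg fun ℓ _ => Finset.sum_nonneg fun k _ => hFterm t ℓ k
  have hFlim : Tendsto (fun t => F (H t)) atTop (nhds 0) := by
    have hΦc : Continuous fun X : 𝓗 →L[ℝ] 𝓗 => ∑ ℓ, w ℓ * ⟪e ℓ, X (e ℓ)⟫ := by fun_prop
    have hK := isCompact_closedBall (0 : 𝓗 →L[ℝ] 𝓗) ‖H₀‖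
    obtain ⟨m, hm⟩ := (hK.image hΦc).bddBelow
    refine tendsto_zero_of_dissipation_of_isCompact hK
      (V := fun X => X * G X - G X * X) (by fun_prop) hHbound hHODE hFc hF0
      (φ := fun t => ∑ ℓ, w ℓ * ⟪e ℓ, H t (e ℓ)⟫) ?_ (m := m)
      (fun t ht => hm (mem_image_of_mem _ (hHbound t ht)))
    intro t ht
    have hd : HasDerivWithinAt (fun t => ∑ ℓ, w ℓ * ⟪e ℓ, H t (e ℓ)⟫)
        (∑ ℓ, w ℓ * ⟪e ℓ, (H t * G (H t) - G (H t) * H t) (e ℓ)⟫) (Ici 0) t := by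
      refine HasDerivWithinAt.fun_sum fun ℓ _ => HasDerivWithinAt.const_mul _ ?_
      have h1 := (hHODE t ht).clm_apply (hasDerivWithinAt_const t (Ici 0) (e ℓ))
      simpa using (hasDerivWithinAt_const t (Ici 0) (e ℓ)).inner ℝ h1
    convert hd using 1
    simp only [hF, neg_neg, Finset.mul_sum]
    refine Finset.sum_congr rfl fun ℓ _ => ?_
    change _ = w ℓ * ⟪e ℓ, H t (G (H t) (e ℓ)) - G (H t) (H t (e ℓ))⟫
    have h1 := hGskew _ (hHsym t) (e ℓ) (H t (e ℓ))
    rw [real_inner_comm] at h1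
    rw [inner_sub_right, ← hHsym]
    linear_combination w ℓ * h1
  have hoff : ∀ i j, i ≠ j →
      Tendsto (fun t => ⟪e j, (adjoint (U t) * H₀ * U t) (e i)⟫) atTop (nhds 0) := by
    intro i j hij
    simp only [← hHdef]
    have hc := hwpos i j hij.symm
    have hsq : Tendsto (fun t => ⟪e j, H t (e i)⟫ ^ 2) atTop (nhds 0) := by
      refine squeeze_zero (fun t => sq_nonneg _) (fun t => ?_)
        (by simpa only [mul_zero] using hFlim.const_mul ((w j - w i) * g j i)⁻¹)
      rw [← div_eq_inv_mul, le_div_iff₀ hc, mul_comm, hFeq]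
      exact (Finset.single_le_sum (fun k _ => hFterm t j k) (Finset.mem_univ i)).trans
        (Finset.single_le_sum (f := fun ℓ => ∑ k, (w ℓ - w k) * g ℓ k * ⟪e ℓ, H t (e k)⟫ ^ 2)
          (fun ℓ _ => Finset.sum_nonneg fun k _ => hFterm t ℓ k) (Finset.mem_univ j))
    rw [tendsto_zero_iff_abs_tendsto_zero]
    simpa [Function.comp_def, Real.sqrt_sq_eq_abs] using hsq.sqrt
  obtain ⟨Uinf, hUlim, hcol⟩ := exists_tendsto_of_offDiag_tendsto_zero e f hβ hH₀sym hf
    (fun t ht => (hUODE t ht).continuousWithinAt) hUU hUU' hoff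
  refine ⟨Uinf, hUlim, ?_⟩
  have hisoinf : ∀ x, ‖Uinf x‖ = ‖x‖ := by
    intro x
    have hl := (((ContinuousLinearMap.apply ℝ 𝓗 x).continuous.tendsto _).comp hUlim).norm
    refine tendsto_nhds_unique hl (tendsto_const_nhds.congr' ?_)
    filter_upwards [eventually_ge_atTop 0] with t ht
    exact ((norm_map_iff_adjoint_comp_self (U t)).2 (hUU t ht) x).symm
  obtain ⟨τ, s, hs, hτ⟩ := f.exists_perm_sign_of_orthonormal
    (e.orthonormal.comp_linearIsometry ⟨Uinf.toLinearMap, hisoinf⟩) hcol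
  rintro Q₀ ⟨hQ, hQ'⟩ β' - hQdiag
  have hQiso : ∀ x, ‖adjoint Q₀ x‖ = ‖x‖ :=
    (norm_map_iff_adjoint_comp_self (adjoint Q₀)).2 (by rw [adjoint_adjoint]; exact hQ')
  have hQQ : ∀ x, adjoint Q₀ (Q₀ x) = x := fun x => DFunLike.congr_fun hQ x
  have hQQ' : ∀ x, Q₀ (adjoint Q₀ x) = x := fun x => DFunLike.congr_fun hQ' x
  have hQeig : ∀ j, H₀ (adjoint Q₀ (e j)) = β' j • adjoint Q₀ (e j) := by
    intro j
    rw [← map_smul, ← hQdiag j]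
    exact (hQQ _).symm
  obtain ⟨ρ, r, hr, hρ⟩ := f.exists_perm_sign_of_orthonormal
    (e.orthonormal.comp_linearIsometry ⟨(adjoint Q₀).toLinearMap, hQiso⟩) (by
      intro j k l hkl
      have hk : ∀ k, (β k - β' j) * ⟪f k, adjoint Q₀ (e j)⟫ = 0 := by
        intro k
        have := hH₀sym (f k) (adjoint Q₀ (e j))
        rw [hf, hQeig, real_inner_smul_left, real_inner_smul_right] at this
        linarith
      by_contra hcon
      obtain ⟨h1, h2⟩ := mul_ne_zero_iff.1 hcon
      have h3 := (mul_eq_zero.1 (hk k)).resolve_right h1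
      have h4 := (mul_eq_zero.1 (hk l)).resolve_right h2
      exact hkl (hβ (by linarith)))
  have hsq : ∀ j, r j * r j = 1 := fun j => by rcases hr j with h | h <;> rw [h] <;> norm_num
  have hQf : ∀ j, Q₀ (f (ρ j)) = r j • e j := by
    intro j
    have h1 : adjoint Q₀ (e j) = r j • f (ρ j) := hρ j
    have h2 : f (ρ j) = r j • adjoint Q₀ (e j) := by rw [h1, smul_smul, hsq, one_smul]
    rw [h2, map_smul, hQQ']
  have hQUinf : ∀ i, Q₀ (Uinf (e i)) = (s i * r (ρ.symm (τ i))) • e (ρ.symm (τ i)) := by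
    intro i
    have h1 : Uinf (e i) = s i • f (τ i) := hτ i
    have h2 := hQf (ρ.symm (τ i))
    rw [ρ.apply_symm_apply] at h2
    rw [h1, map_smul, h2, smul_smul]
  refine ⟨(τ.trans ρ.symm).symm, ((e.equiv e (τ.trans ρ.symm).symm).toContinuousLinearEquiv :
    𝓗 →L[ℝ] 𝓗), fun i => s i * r (ρ.symm (τ i)), fun i => ?_, fun i => ?_, fun i => ?_⟩
  · exact e.equiv_apply_basis e _ i
  · rcases hs i with h | h <;> rcases hr (ρ.symm (τ i)) with h' | h' <;> simp [h, h']
  · change e.equiv e (τ.trans ρ.symm).symm (Q₀ (Uinf (e i))) = _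
    rw [hQUinf, map_smul, e.equiv_apply_basis]
    congr 2
    exact (τ.trans ρ.symm).symm_apply_apply i
end
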